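/- arXiv:math/0310411 — 4 statements merged into one kernel-verified Lean document; each statement's English description precedes it below -/
import Mathlib

section
/- For every ε > 0 there exists N such that for all even integers m, n with min{m,n} ≥ N, every Eulerian orientation of the complete bipartite graph K_{m,n} contains at least (1/(4+√8))·mn·(1−ε) pairwise arc-disjoint directed 4-cycles. -/
open Finset

/-- An orientation of the complete bipartite graph `K_{m,n}`: `o a b = true` means the edge
between left vertex `a` and right vertex `b` is directed from `a` to `b`, and
`o a b = false` means it is directed from `b` to `a`. -/
def IsEulerianBip {m n : ℕ} (o : Fin m → Fin n → Bool) : Prop :=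
  (∀ a : Fin m, 2 * (univ.filter fun b : Fin n => o a b = true).card = n) ∧
  (∀ b : Fin n, 2 * (univ.filter fun a : Fin m => o a b = true).card = m)

/-- A quadruple `(a₁, a₂, b₁, b₂)` encodes the directed 4-cycle `a₁ → b₁ → a₂ → b₂ → a₁`
in the orientation `o` of `K_{m,n}`. -/
def IsDirC4 {m n : ℕ} (o : Fin m → Fin n → Bool)
    (q : Fin m × Fin m × Fin n × Fin n) : Prop :=
  q.1 ≠ q.2.1 ∧ q.2.2.1 ≠ q.2.2.2 ∧
  o q.1 q.2.2.1 = true ∧ o q.2.1 q.2.2.1 = false ∧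
  o q.2.1 q.2.2.2 = true ∧ o q.1 q.2.2.2 = false

/-- The four arcs (identified with the underlying edges of `K_{m,n}`, since the orientation
is fixed) of the directed 4-cycle encoded by `q`. -/
def c4Arcs {m n : ℕ} (q : Fin m × Fin m × Fin n × Fin n) : Finset (Fin m × Fin n) :=
  {(q.1, q.2.2.1), (q.2.1, q.2.2.1), (q.2.1, q.2.2.2), (q.1, q.2.2.2)}

namespace C4Packing

/-- The number of columns of `g` in which row `i` carries `true` and row `j` carries `false`. -/
def discord {ι κ : Type*} [Fintype κ] (g : ι → κ → Bool) (i j : ι) : ℕ :=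
  (univ.filter fun b : κ => g i b = true ∧ g j b = false).card

lemma discord_self {ι κ : Type*} [Fintype κ] (g : ι → κ → Bool) (i : ι) : discord g i i = 0 := by
  simp [discord]

lemma discord_add {ι κ : Type*} [Fintype κ] (g : ι → κ → Bool) (i j : ι) :
    discord g i j + (univ.filter fun b : κ => g i b = true ∧ g j b = true).card =
      (univ.filter fun b : κ => g i b = true).card := by
  classical
  unfold discord
  rw [← Finset.card_union_of_disjoint]
  · congr 1
    ext b
    cases h : g j b <;> simp [h]
  · rw [Finset.disjoint_left]
    intro b
    simp +contextual

lemma discord_comm {ι κ : Type*} [Fintype κ] {g : ι → κ → Bool} {i j : ι}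
    (h : (univ.filter fun b : κ => g i b = true).card =
      (univ.filter fun b : κ => g j b = true).card) :
    discord g i j = discord g j i := by
  have h1 := discord_add g i j
  have h2 := discord_add g j i
  have h3 : (univ.filter fun b : κ => g i b = true ∧ g j b = true) =
      univ.filter fun b : κ => g j b = true ∧ g i b = true := by
    ext b; simp [and_comm]
  rw [h3] at h1
  omega

lemma sum_ite_discord {ι : Type*} [Fintype ι] (s : ι → Bool) (x : ℝ) :
    ∑ i, ∑ j, (if s i = true ∧ s j = false then x else 0) =
      ((univ.filter fun i => s i = true).card * (univ.filter fun i => s i = false).card : ℕ) * x := by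
  rw [← Finset.card_product, ← Finset.sum_product', ← Finset.sum_filter]
  rw [Finset.sum_const, nsmul_eq_mul]
  congr 3
  ext ⟨i, j⟩
  simp

lemma sum_discord {ι κ : Type*} [Fintype ι] [Fintype κ] (g : ι → κ → Bool) :
    ∑ i, ∑ j, (discord g i j : ℝ) =
      ∑ b, ((univ.filter fun i => g i b = true).card *
        (univ.filter fun i => g i b = false).card : ℕ) := by
  have h : ∀ i j, (discord g i j : ℝ) =
      ∑ b, if g i b = true ∧ g j b = false then (1 : ℝ) else 0 := by
    intro i j
    simp [discord]
  simp_rw [h]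
  have h2 : ∀ i, ∑ j, ∑ b, (if g i b = true ∧ g j b = false then (1 : ℝ) else 0) =
      ∑ b, ∑ j, (if g i b = true ∧ g j b = false then (1 : ℝ) else 0) :=
    fun i => Finset.sum_comm
  simp_rw [h2]
  rw [Finset.sum_comm]
  push_cast
  refine Finset.sum_congr rfl fun b _ => ?_
  have := sum_ite_discord (fun i => g i b) 1
  push_cast at this
  rw [this, mul_one]

section Averaging

lemma exists_perm_pair {α : Type*} [DecidableEq α] {i j i' j' : α} (h : i ≠ j) (h' : i' ≠ j') :
    ∃ τ : Equiv.Perm α, τ i = i' ∧ τ j = j' := by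
  refine ⟨Equiv.swap (Equiv.swap i i' j) j' * Equiv.swap i i', ?_, ?_⟩
  · rw [Equiv.Perm.mul_apply, Equiv.swap_apply_left]
    refine Equiv.swap_apply_of_ne_of_ne ?_ h'
    intro hc
    apply h
    apply (Equiv.swap i i').injective
    rw [Equiv.swap_apply_left, ← hc]
  · rw [Equiv.Perm.mul_apply, Equiv.swap_apply_left]

variable {α : Type*} [Fintype α] [DecidableEq α]

lemma sum_perm_pair_eq (f : α → α → ℝ) {i j i' j' : α} (h : i ≠ j) (h' : i' ≠ j') :
    ∑ σ : Equiv.Perm α, f (σ i') (σ j') = ∑ σ : Equiv.Perm α, f (σ i) (σ j) := by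
  obtain ⟨τ, rfl, rfl⟩ := exists_perm_pair h h'
  exact Equiv.sum_comp (Equiv.mulRight τ) fun σ : Equiv.Perm α => f (σ i) (σ j)

lemma card_mul_sum_perm_pair (f : α → α → ℝ) (hf : ∀ a, f a a = 0) {i j : α} (h : i ≠ j) :
    (Fintype.card α * (Fintype.card α - 1) : ℝ) * ∑ σ : Equiv.Perm α, f (σ i) (σ j) =
      Fintype.card (Equiv.Perm α) * ∑ a, ∑ b, f a b := by
  have h1 : ∀ σ : Equiv.Perm α, ∑ a, ∑ b, f (σ a) (σ b) = ∑ a, ∑ b, f a b := by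
    intro σ
    rw [Equiv.sum_comp σ fun a => ∑ b, f a (σ b)]
    exact Finset.sum_congr rfl fun a _ => Equiv.sum_comp σ fun b => f a b
  have h2 : ∑ σ : Equiv.Perm α, ∑ a, ∑ b, f (σ a) (σ b) =
      Fintype.card (Equiv.Perm α) * ∑ a, ∑ b, f a b := by
    rw [Finset.sum_congr rfl fun σ _ => h1 σ, Finset.sum_const, nsmul_eq_mul, Finset.card_univ]
  have h3 : ∀ a b, ∑ σ : Equiv.Perm α, f (σ a) (σ b) =
      if a = b then 0 else ∑ σ : Equiv.Perm α, f (σ i) (σ j) := by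
    intro a b
    split_ifs with hab
    · subst hab; simp [hf]
    · exact sum_perm_pair_eq f h hab
  have h5 : ∑ σ : Equiv.Perm α, ∑ a, ∑ b, f (σ a) (σ b) =
      ∑ a, ∑ b, ∑ σ : Equiv.Perm α, f (σ a) (σ b) := by
    rw [Finset.sum_comm]
    exact Finset.sum_congr rfl fun a _ => Finset.sum_comm
  rw [← h2, h5]
  generalize ∑ σ : Equiv.Perm α, f (σ i) (σ j) = x at h3 ⊢
  simp_rw [h3, Finset.sum_ite]
  simp only [Finset.sum_const, nsmul_eq_mul, mul_zero, zero_add]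
  have h4 : ∀ a : α, ((univ.filter fun b => ¬ a = b).card : ℝ) = Fintype.card α - 1 := by
    intro a
    rw [Finset.filter_ne, Finset.card_erase_of_mem (Finset.mem_univ a), Finset.card_univ,
      Nat.cast_pred (Fintype.card_pos_iff.2 ⟨a⟩)]
  simp [h4]
  ring

/-- Some permutation does at least as well as the average one on a given family of pairs. -/
lemma exists_perm_le_sum {ι : Type*} (P : Finset ι) (u v : ι → α) (huv : ∀ x ∈ P, u x ≠ v x)
    (f : α → α → ℝ) (hf : ∀ a, f a a = 0) :
    ∃ σ : Equiv.Perm α, P.card * ∑ a, ∑ b, f a b ≤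
      (Fintype.card α * (Fintype.card α - 1) : ℝ) * ∑ x ∈ P, f (σ (u x)) (σ (v x)) := by
  have key : ∑ _σ : Equiv.Perm α, (P.card * ∑ a, ∑ b, f a b) ≤ ∑ σ : Equiv.Perm α,
      (Fintype.card α * (Fintype.card α - 1) : ℝ) * ∑ x ∈ P, f (σ (u x)) (σ (v x)) := by
    apply le_of_eq
    conv_rhs => rw [← Finset.mul_sum, Finset.sum_comm, Finset.mul_sum]
    rw [Finset.sum_congr rfl fun x hx => card_mul_sum_perm_pair f hf (huv x hx)]
    simp
    ring
  obtain ⟨σ, -, h⟩ := Finset.exists_le_of_sum_le Finset.univ_nonempty key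
  exact ⟨σ, h⟩

end Averaging

/-- A complete bipartite graph with both sides of size at most `M` is properly edge-coloured
with `M` colours. -/
lemma exists_proper_colouring {K : Type*} [Fintype K] (s : K → Bool) (M : ℕ) (hM : 0 < M)
    (hp : (univ.filter fun i => s i = true).card ≤ M)
    (hq : (univ.filter fun i => s i = false).card ≤ M) :
    ∃ χ : K → K → ℕ, (∀ i j, χ i j < M) ∧
      (∀ i j j', s j = false → s j' = false → χ i j = χ i j' → j = j') ∧
      (∀ i i' j, s i = true → s i' = true → χ i j = χ i' j → i = i') := by
  have : NeZero M := ⟨hM.ne'⟩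
  have h : ∀ c : Bool, (univ.filter fun i => s i = c).card ≤ M →
      ∃ e : K → ZMod M, Set.InjOn e {i | s i = c} := by
    intro c hc
    have hle : Fintype.card {i // s i = c} ≤ Fintype.card (ZMod M) := by
      rwa [ZMod.card, Fintype.card_subtype]
    obtain ⟨φ⟩ := Function.Embedding.nonempty_of_card_le hle
    refine ⟨fun i => if h : s i = c then φ ⟨i, h⟩ else 0, fun i hi j hj hij => ?_⟩
    have hi' : s i = c := hi
    have hj' : s j = c := hj
    simpa [hi', hj'] using hij
  obtain ⟨e, he⟩ := h true hp
  obtain ⟨f, hf⟩ := h false hq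
  refine ⟨fun i j => (e i + f j).val, fun i j => ZMod.val_lt _, ?_, ?_⟩
  · intro i j j' hj hj' hh
    exact hf hj hj' (add_left_cancel (ZMod.val_injective M hh))
  · intro i i' j hi hi' hh
    exact he hi hi' (add_right_cancel (ZMod.val_injective M hh))

/-- A finite set can be labelled so that each of `M` labels is used about equally often. -/
lemma exists_balanced_labelling {κ : Type*} (F : Finset κ) (M : ℕ) (hM : 0 < M) :
    ∃ l : κ → ℕ, ∀ c < M, (F.card : ℝ) / M - 1 ≤ (F.filter fun b => l b = c).card := by
  classical
  let rank : κ → ℕ := fun b => if h : b ∈ F then F.equivFin ⟨b, h⟩ else 0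
  refine ⟨fun b => rank b % M, fun c hc => ?_⟩
  have h1 : F.card / M ≤ (F.filter fun b => rank b % M = c).card := by
    conv_lhs => rw [← Finset.card_range (F.card / M)]
    refine Finset.card_le_card_of_surjOn (fun b => rank b / M) fun t ht => ?_
    have hlt : t * M + c < F.card := by
      have h2 : (t + 1) * M ≤ F.card :=
        (Nat.mul_le_mul_right M (Finset.mem_range.1 ht)).trans (Nat.div_mul_le_self _ _)
      nlinarith
    have hr : rank (F.equivFin.symm ⟨t * M + c, hlt⟩) = t * M + c := by
      simp [rank]
    refine ⟨F.equivFin.symm ⟨t * M + c, hlt⟩, ?_, ?_⟩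
    · simp only [Finset.coe_filter, Set.mem_ofPred_eq, hr]
      exact ⟨Subtype.coe_prop _, by rw [Nat.mul_add_mod', Nat.mod_eq_of_lt hc]⟩
    · simp only [hr]
      rw [mul_comm, Nat.mul_add_div hM, Nat.div_eq_of_lt hc, add_zero]
  have h2 : (F.card : ℝ) / M - 1 ≤ (F.card / M : ℕ) := by
    have := Nat.lt_floor_add_one ((F.card : ℝ) / M)
    rw [Nat.floor_div_eq_div] at this
    linarith
  exact h2.trans (by exact_mod_cast h1)

/-- Two finite sets have a partial matching that saturates the smaller one. -/
lemma exists_matching_card_eq_min {κ : Type*} [DecidableEq κ] (A B : Finset κ) :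
    ∃ P : Finset (κ × κ), P.card = min A.card B.card ∧ (∀ p ∈ P, p.1 ∈ A ∧ p.2 ∈ B) ∧
      (∀ p ∈ P, ∀ p' ∈ P, p.1 = p'.1 → p = p') ∧ (∀ p ∈ P, ∀ p' ∈ P, p.2 = p'.2 → p = p') := by
  obtain ⟨A', hA, hA'⟩ := Finset.exists_subset_card_eq (min_le_left A.card B.card)
  obtain ⟨B', hB, hB'⟩ := Finset.exists_subset_card_eq (min_le_right A.card B.card)
  let φ : A' ≃ B' := Finset.equivOfCardEq (hA'.trans hB'.symm)
  refine ⟨univ.image fun a : A' => ((a : κ), (φ a : κ)), ?_, ?_, ?_, ?_⟩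
  · rw [Finset.card_image_of_injective _ fun a b h => Subtype.ext (Prod.ext_iff.1 h).1]
    simpa using hA'
  · simp only [Finset.mem_image, Finset.mem_univ, true_and]
    rintro _ ⟨a, rfl⟩
    exact ⟨hA a.2, hB (φ a).2⟩
  · simp only [Finset.mem_image, Finset.mem_univ, true_and]
    rintro _ ⟨a, rfl⟩ _ ⟨b, rfl⟩ h
    rw [show a = b from Subtype.ext h]
  · simp only [Finset.mem_image, Finset.mem_univ, true_and]
    rintro _ ⟨a, rfl⟩ _ ⟨b, rfl⟩ h
    rw [show a = b from φ.injective (Subtype.ext h)]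

lemma mem_c4Arcs {m n : ℕ} {q : Fin m × Fin m × Fin n × Fin n} {x : Fin m × Fin n} :
    x ∈ c4Arcs q ↔ (x.1 = q.1 ∨ x.1 = q.2.1) ∧ (x.2 = q.2.2.1 ∨ x.2 = q.2.2.2) := by
  obtain ⟨a, b⟩ := x
  simp only [c4Arcs, Finset.mem_insert, Finset.mem_singleton, Prod.mk.injEq]
  tauto

/-- Pairing up columns: a family of matchings, one in each column, between the rows carrying
`true` and the rows carrying `false` yields arc-disjoint directed 4-cycles. -/
lemma exists_packing_of_matchings {m n : ℕ} (o : Fin m → Fin n → Bool) {K : Type*} [Fintype K]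
    [LinearOrder K] (r : K → Fin m) (hr : Function.Injective r) (T : K → K → Finset (Fin n))
    (hT : ∀ i j, ∀ b ∈ T i j, o (r i) b = true ∧ o (r j) b = false)
    (hT₁ : ∀ i j j' b, b ∈ T i j → b ∈ T i j' → j = j')
    (hT₂ : ∀ i i' j b, b ∈ T i j → b ∈ T i' j → i = i') :
    ∃ S : Finset (Fin m × Fin m × Fin n × Fin n),
      (∀ q ∈ S, IsDirC4 o q) ∧
      (∀ q ∈ S, ∀ q' ∈ S, q ≠ q' → Disjoint (c4Arcs q) (c4Arcs q')) ∧
      (∀ q ∈ S, q.1 ∈ Set.range r ∧ q.2.1 ∈ Set.range r) ∧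
      S.card = ∑ i, ∑ j, if i < j then min (T i j).card (T j i).card else 0 := by
  choose P hPcard hPmem hP₁ hP₂ using fun i j => exists_matching_card_eq_min (T i j) (T j i)
  have hsame : ∀ i j k l b a, b ∈ T i j → b ∈ T k l → (a = r i ∨ a = r j) →
      (a = r k ∨ a = r l) → i = k ∧ j = l := by
    intro i j k l b a h h' ha ha'
    have h1 := hT i j b h
    have h2 := hT k l b h'
    rcases ha with rfl | rfl <;> rcases ha' with ha' | ha'
    · obtain rfl := hr ha'
      exact ⟨rfl, hT₁ _ _ _ _ h h'⟩
    · rw [ha', h2.2] at h1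
      simp at h1
    · rw [ha', h2.1] at h1
      simp at h1
    · obtain rfl := hr ha'
      exact ⟨hT₂ _ _ _ _ h h', rfl⟩
  let I : Finset (K × K) := univ.filter fun x => x.1 < x.2
  let f : (Σ _ : K × K, Fin n × Fin n) → Fin m × Fin m × Fin n × Fin n :=
    fun x => (r x.1.1, r x.1.2, x.2)
  have hf : Function.Injective f := by
    rintro ⟨⟨i, j⟩, p⟩ ⟨⟨k, l⟩, p'⟩ h
    simp only [f, Prod.mk.injEq] at h
    obtain ⟨h1, h2, rfl⟩ := h
    obtain rfl := hr h1
    obtain rfl := hr h2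
    rfl
  refine ⟨(I.sigma fun x => P x.1 x.2).image f, ?_, ?_, ?_, ?_⟩
  · simp only [Finset.mem_image, Finset.mem_sigma]
    rintro _ ⟨⟨⟨i, j⟩, b, b'⟩, ⟨hij, hp⟩, rfl⟩
    have hij : i < j := (Finset.mem_filter.1 hij).2
    have hb := hT _ _ _ (hPmem _ _ _ hp).1
    have hb' := hT _ _ _ (hPmem _ _ _ hp).2
    refine ⟨fun h => hij.ne (hr h), ?_, hb.1, hb.2, hb'.1, hb'.2⟩
    rintro (rfl : b = b')
    exact Bool.noConfusion (hb.1.symm.trans hb'.2)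
  · simp only [Finset.mem_image, Finset.mem_sigma]
    rintro _ ⟨⟨⟨i, j⟩, b, b'⟩, ⟨hij, hp⟩, rfl⟩ _ ⟨⟨⟨k, l⟩, c, c'⟩, ⟨hkl, hp'⟩, rfl⟩ hne
    have hij' : i < j := (Finset.mem_filter.1 hij).2
    have hkl' : k < l := (Finset.mem_filter.1 hkl).2
    obtain ⟨hb, hb'⟩ := hPmem _ _ _ hp
    obtain ⟨hc, hc'⟩ := hPmem _ _ _ hp'
    dsimp only at hp hp' hb hb' hc hc'
    rw [Finset.disjoint_left]
    rintro ⟨a, β⟩ hx hx'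
    rw [mem_c4Arcs] at hx hx'
    dsimp only [f] at hx hx'
    apply hne
    obtain ⟨hx, rfl | rfl⟩ := hx <;> obtain ⟨hx', rfl | rfl⟩ := hx'
    · obtain ⟨rfl, rfl⟩ := hsame _ _ _ _ _ _ hb hc hx hx'
      rw [hP₁ _ _ _ hp _ hp' rfl]
    · obtain ⟨rfl, rfl⟩ := hsame _ _ _ _ _ _ hb hc' hx hx'.symm
      exact absurd hij' hkl'.not_gt
    · obtain ⟨rfl, rfl⟩ := hsame _ _ _ _ _ _ hb' hc hx.symm hx'
      exact absurd hij' hkl'.not_gt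
    · obtain ⟨rfl, rfl⟩ := hsame _ _ _ _ _ _ hb' hc' hx.symm hx'.symm
      rw [hP₂ _ _ _ hp _ hp' rfl]
  · simp only [Finset.mem_image, Finset.mem_sigma]
    rintro _ ⟨x, -, rfl⟩
    exact ⟨⟨_, rfl⟩, ⟨_, rfl⟩⟩
  · rw [Finset.card_image_of_injective _ hf, Finset.card_sigma, ← Finset.sum_product',
      Finset.sum_filter]
    simp only [hPcard]
    rfl

/-- Within eight rows of an Eulerian orientation one can pack directed 4-cycles efficiently. -/
lemma exists_block_packing {m n : ℕ} (o : Fin m → Fin n → Bool)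
    (ho : ∀ a : Fin m, 2 * (univ.filter fun b : Fin n => o a b = true).card = n)
    (r : Fin 8 → Fin m) (hr : Function.Injective r) :
    ∃ S : Finset (Fin m × Fin m × Fin n × Fin n),
      (∀ q ∈ S, IsDirC4 o q) ∧
      (∀ q ∈ S, ∀ q' ∈ S, q ≠ q' → Disjoint (c4Arcs q) (c4Arcs q')) ∧
      (∀ q ∈ S, q.1 ∈ Set.range r ∧ q.2.1 ∈ Set.range r) ∧
      (∑ i, ∑ j, (discord o (r i) (r j) : ℝ)) / 5 - 8 / 5 * n - 16384 ≤ S.card := by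
  let typ : Fin n → Fin 8 → Bool := fun b i => o (r i) b
  let M : (Fin 8 → Bool) → ℕ := fun s => max 5 (max (univ.filter fun i => s i = true).card
    (univ.filter fun i => s i = false).card)
  have hM : ∀ s, 0 < M s := fun s => by simp [M]
  choose χ hχ hχ₁ hχ₂ using fun s : Fin 8 → Bool =>
    exists_proper_colouring s (M s) (hM s) (by simp [M]) (by simp [M])
  choose l hl using fun s : Fin 8 → Bool =>
    exists_balanced_labelling (univ.filter fun b => typ b = s) (M s) (hM s)
  let T : Fin 8 → Fin 8 → Finset (Fin n) := fun i j => univ.filter fun b =>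
    (typ b i = true ∧ typ b j = false) ∧ l (typ b) b = χ (typ b) i j
  have hT₁ : ∀ i j j' b, b ∈ T i j → b ∈ T i j' → j = j' := by
    intro i j j' b hb hb'
    simp only [T, Finset.mem_filter] at hb hb'
    exact hχ₁ _ _ _ _ hb.2.1.2 hb'.2.1.2 (hb.2.2.symm.trans hb'.2.2)
  have hT₂ : ∀ i i' j b, b ∈ T i j → b ∈ T i' j → i = i' := by
    intro i i' j b hb hb'
    simp only [T, Finset.mem_filter] at hb hb'
    exact hχ₂ _ _ _ _ hb.2.1.1 hb'.2.1.1 (hb.2.2.symm.trans hb'.2.2)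
  obtain ⟨S, hS₁, hS₂, hS₃, hS⟩ := exists_packing_of_matchings o r hr T
    (fun i j b hb => (Finset.mem_filter.1 hb).2.1) hT₁ hT₂
  refine ⟨S, hS₁, hS₂, hS₃, ?_⟩
  have hcard : ∀ i j, ∑ b, (if typ b i = true ∧ typ b j = false then (1 : ℝ) / M (typ b) else 0)
      - 256 ≤ (T i j).card := by
    intro i j
    have h1 : ((T i j).card : ℝ) = ∑ s : Fin 8 → Bool,
        (((T i j).filter fun b => typ b = s).card : ℝ) := by
      rw [Finset.card_eq_sum_card_fiberwise (f := typ) (t := univ) (by simp)]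
      push_cast
      rfl
    rw [h1, ← Finset.sum_fiberwise (s := univ) (g := typ)]
    have h2 : (256 : ℝ) = ∑ _s : Fin 8 → Bool, (1 : ℝ) := by simp
    rw [h2, ← Finset.sum_sub_distrib]
    refine Finset.sum_le_sum fun s _ => ?_
    by_cases hs : s i = true ∧ s j = false
    · have h3 : ∑ b with typ b = s, (if typ b i = true ∧ typ b j = false then
          (1 : ℝ) / M (typ b) else 0) = ((univ.filter fun b => typ b = s).card : ℝ) / M s := by
        rw [Finset.sum_congr rfl fun b hb => ?_, Finset.sum_const, nsmul_eq_mul, mul_one_div]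
        rw [(Finset.mem_filter.1 hb).2, if_pos hs]
      have h4 : (T i j).filter (fun b => typ b = s) =
          (univ.filter fun b => typ b = s).filter fun b => l s b = χ s i j := by
        ext b
        simp only [T, Finset.mem_filter, Finset.mem_univ, true_and]
        constructor
        · rintro ⟨⟨-, h⟩, rfl⟩; exact ⟨rfl, h⟩
        · rintro ⟨rfl, h⟩; exact ⟨⟨hs, h⟩, rfl⟩
      rw [h3, h4]
      exact hl s _ (hχ s i j)
    · have h3 : ∑ b with typ b = s, (if typ b i = true ∧ typ b j = false then
          (1 : ℝ) / M (typ b) else 0) = 0 := by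
        refine Finset.sum_eq_zero fun b hb => ?_
        rw [(Finset.mem_filter.1 hb).2, if_neg hs]
      rw [h3]
      have : (0 : ℝ) ≤ (((T i j).filter fun b => typ b = s).card : ℝ) := Nat.cast_nonneg _
      linarith
  let L : Fin 8 → Fin 8 → ℝ := fun i j =>
    ∑ b, (if typ b i = true ∧ typ b j = false then (1 : ℝ) / 5 - 1 / M (typ b) else 0)
  have hL0 : ∀ i j, 0 ≤ L i j := by
    intro i j
    refine Finset.sum_nonneg fun b _ => ?_
    split_ifs
    · have : (5 : ℝ) ≤ M (typ b) := by exact_mod_cast le_max_left _ _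
      have := one_div_le_one_div_of_le (by norm_num) this
      linarith
    · exact le_rfl
  have hTL : ∀ i j, (discord o (r i) (r j) : ℝ) / 5 - L i j - 256 ≤ (T i j).card := by
    intro i j
    refine le_trans (le_of_eq ?_) (hcard i j)
    have : (discord o (r i) (r j) : ℝ) / 5 =
        ∑ b, (if typ b i = true ∧ typ b j = false then (1 : ℝ) / 5 else 0) := by
      rw [← Finset.sum_filter, Finset.sum_const, nsmul_eq_mul, mul_one_div]
      rfl
    rw [this, ← Finset.sum_sub_distrib]
    congr 1
    refine Finset.sum_congr rfl fun b _ => ?_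
    split_ifs <;> ring
  have hsymm : ∀ i j, discord o (r i) (r j) = discord o (r j) (r i) := by
    intro i j
    apply discord_comm
    have h1 := ho (r i)
    have h2 := ho (r j)
    omega
  let G : Fin 8 → Fin 8 → ℝ := fun i j => (discord o (r i) (r j) : ℝ) / 10 - L i j
  have hmin : ∀ i j, G i j + G j i - 256 ≤ (min (T i j).card (T j i).card : ℕ) := by
    intro i j
    have h1 := hTL i j
    have h2 := hTL j i
    have h3 := hL0 i j
    have h4 := hL0 j i
    have h5 : (discord o (r i) (r j) : ℝ) = discord o (r j) (r i) := by rw [hsymm]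
    rw [Nat.cast_min]
    refine le_min ?_ ?_ <;> simp only [G] <;> linarith
  have hG0 : ∀ i, G i i = 0 := by
    intro i
    simp [G, discord_self, L]
  have hGsum : ∑ i, ∑ j, (if i < j then G i j + G j i else 0) = ∑ i, ∑ j, G i j := by
    have h1 : ∑ i, ∑ j, (if i < j then G i j + G j i else 0) =
        ∑ i, ∑ j, (if i < j then G i j else 0) + ∑ i, ∑ j, (if i < j then G j i else 0) := by
      simp_rw [← Finset.sum_add_distrib]
      refine Finset.sum_congr rfl fun i _ => Finset.sum_congr rfl fun j _ => ?_
      split_ifs <;> simp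
    rw [h1, Finset.sum_comm (f := fun i j => if i < j then G j i else (0 : ℝ)),
      ← Finset.sum_add_distrib]
    refine Finset.sum_congr rfl fun i _ => ?_
    rw [← Finset.sum_add_distrib]
    refine Finset.sum_congr rfl fun j _ => ?_
    rcases lt_trichotomy i j with h | h | h
    · simp [h, h.not_gt]
    · subst h; simp [hG0]
    · simp [h, h.not_gt]
  have hSG : ∑ i, ∑ j, G i j - 16384 ≤ S.card := by
    rw [← hGsum, hS]
    have h2 : (16384 : ℝ) = ∑ _i : Fin 8, ∑ _j : Fin 8, (256 : ℝ) := by norm_num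
    rw [h2, ← Finset.sum_sub_distrib]
    push_cast
    refine Finset.sum_le_sum fun i _ => ?_
    rw [← Finset.sum_sub_distrib]
    refine Finset.sum_le_sum fun j _ => ?_
    have := hmin i j
    split_ifs
    · exact_mod_cast this
    · norm_num
  have hLsum : ∑ i, ∑ j, L i j ≤ 8 / 5 * n - (∑ i, ∑ j, (discord o (r i) (r j) : ℝ)) / 10 := by
    have h1 : ∑ i, ∑ j, L i j = ∑ b, ∑ i, ∑ j,
        (if typ b i = true ∧ typ b j = false then (1 : ℝ) / 5 - 1 / M (typ b) else 0) := by
      rw [Finset.sum_comm (s := (univ : Finset (Fin n)))]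
      exact Finset.sum_congr rfl fun i _ => Finset.sum_comm
    have h2 : ∑ i, ∑ j, (discord o (r i) (r j) : ℝ) =
        ∑ b, ((univ.filter fun i => o (r i) b = true).card *
          (univ.filter fun i => o (r i) b = false).card : ℕ) :=
      sum_discord fun i b => o (r i) b
    rw [h1, h2]
    push_cast
    rw [Finset.sum_div]
    have h3 : 8 / 5 * (n : ℝ) = ∑ _b : Fin n, (8 / 5 : ℝ) := by simp [mul_comm]
    rw [h3, ← Finset.sum_sub_distrib]
    refine Finset.sum_le_sum fun b _ => ?_
    rw [sum_ite_discord]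
    have h4 : (univ.filter fun i => typ b i = true).card +
        (univ.filter fun i => typ b i = false).card = 8 := by
      have := Finset.card_filter_add_card_filter_not (s := (univ : Finset (Fin 8)))
        (fun i => typ b i = true)
      simpa using this
    simp only [M]
    change _ ≤ 8 / 5 - ((univ.filter fun i => typ b i = true).card : ℝ) *
      ((univ.filter fun i => typ b i = false).card : ℝ) / 10
    generalize (univ.filter fun i => typ b i = true).card = p at h4 ⊢
    generalize (univ.filter fun i => typ b i = false).card = q at h4 ⊢
    obtain rfl : q = 8 - p := by omega
    have hp : p ≤ 8 := by omega
    interval_cases p <;> norm_num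
  have hfin : ∑ i, ∑ j, G i j = (∑ i, ∑ j, (discord o (r i) (r j) : ℝ)) / 10 -
      ∑ i, ∑ j, L i j := by
    simp only [G, Finset.sum_sub_distrib, Finset.sum_div]
  linarith

/-- The rows split into blocks of eight whose average discordance is at least the global one. -/
lemma exists_blocks {m n : ℕ} (hm : 8 ≤ m) (o : Fin m → Fin n → Bool) (ho : IsEulerianBip o) :
    ∃ r : Fin (m / 8) × Fin 8 → Fin m, Function.Injective r ∧
      14 * (m / 8 : ℕ) * (n : ℝ) ≤ ∑ t, ∑ i, ∑ j, (discord o (r (t, i)) (r (t, j)) : ℝ) := by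
  let e : Fin (m / 8) × Fin 8 → Fin m := fun x => ⟨x.1 * 8 + x.2, by omega⟩
  have he : Function.Injective e := by
    rintro ⟨t, i⟩ ⟨t', i'⟩ h
    simp only [e, Fin.mk.injEq] at h
    rw [Prod.mk.injEq, Fin.ext_iff, Fin.ext_iff]
    omega
  let I : Finset (Fin 8 × Fin 8) := univ.filter fun x => x.1 ≠ x.2
  have hI : I.card = 56 := by decide
  obtain ⟨σ, hσ⟩ := exists_perm_le_sum ((univ : Finset (Fin (m / 8))) ×ˢ I)
    (fun x => e (x.1, x.2.1)) (fun x => e (x.1, x.2.2))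
    (fun x hx h => (Finset.mem_filter.1 (Finset.mem_product.1 hx).2).2
      (Prod.ext_iff.1 (he h)).2)
    (fun a b => (discord o a b : ℝ)) (fun a => by simp [discord_self])
  refine ⟨σ ∘ e, σ.injective.comp he, ?_⟩
  have hsum : ∑ x ∈ (univ : Finset (Fin (m / 8))) ×ˢ I,
      (discord o (σ (e (x.1, x.2.1))) (σ (e (x.1, x.2.2))) : ℝ) =
      ∑ t, ∑ i, ∑ j, (discord o ((σ ∘ e) (t, i)) ((σ ∘ e) (t, j)) : ℝ) := by
    rw [Finset.sum_product]
    refine Finset.sum_congr rfl fun t _ => ?_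
    rw [← Finset.sum_product', Finset.sum_filter]
    refine Finset.sum_congr rfl fun x _ => ?_
    split_ifs with h
    · rfl
    · simp only [not_not] at h
      simp [h, discord_self]
  have htot : ∑ a, ∑ b, (discord o a b : ℝ) = n * ((m : ℝ) / 2 * (m / 2)) := by
    rw [sum_discord]
    push_cast
    have h1 : ∀ b : Fin n, ((univ.filter fun i => o i b = true).card : ℝ) = m / 2 := by
      intro b
      have : (2 : ℝ) * (univ.filter fun i => o i b = true).card = m := by
        exact_mod_cast ho.2 b
      linarith
    have h2 : ∀ b : Fin n, ((univ.filter fun i => o i b = false).card : ℝ) = m / 2 := by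
      intro b
      have h3 := Finset.card_filter_add_card_filter_not (s := (univ : Finset (Fin m)))
        (fun i => o i b = true)
      simp only [Bool.not_eq_true, Finset.card_univ, Fintype.card_fin] at h3
      have h4 : ((univ.filter fun i => o i b = true).card : ℝ) +
          (univ.filter fun i => o i b = false).card = m := by exact_mod_cast h3
      linarith [h1 b]
    simp only [h1, h2, Finset.sum_const, Finset.card_univ, Fintype.card_fin, nsmul_eq_mul]
  rw [hsum, htot, Finset.card_product, hI, Finset.card_univ, Fintype.card_fin,
    Fintype.card_fin] at hσ
  push_cast at hσ
  generalize ∑ t, ∑ i, ∑ j, (discord o ((σ ∘ e) (t, i)) ((σ ∘ e) (t, j)) : ℝ) = Q at hσ ⊢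
  have hm' : (8 : ℝ) ≤ m := by exact_mod_cast hm
  have h0 : (0 : ℝ) ≤ (m / 8 : ℕ) * n := by positivity
  have h5 : (m * (m - 1) : ℝ) * (14 * (m / 8 : ℕ) * n) ≤ (m * (m - 1) : ℝ) * Q := by
    refine le_trans ?_ hσ
    nlinarith [mul_nonneg h0 (by linarith : (0 : ℝ) ≤ m)]
  exact le_of_mul_le_mul_left h5 (by nlinarith)

lemma exists_packing {m n : ℕ} (hm : 8 ≤ m) (o : Fin m → Fin n → Bool) (ho : IsEulerianBip o) :
    ∃ S : Finset (Fin m × Fin m × Fin n × Fin n),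
      (∀ q ∈ S, IsDirC4 o q) ∧
      (∀ q ∈ S, ∀ q' ∈ S, q ≠ q' → Disjoint (c4Arcs q) (c4Arcs q')) ∧
      (m / 8 : ℕ) * (6 / 5 * n - 16384 : ℝ) ≤ S.card := by
  obtain ⟨r, hr, hsum⟩ := exists_blocks hm o ho
  choose S hS₁ hS₂ hS₃ hS using fun t => exists_block_packing o ho.1 (fun i => r (t, i))
    fun i j h => (Prod.ext_iff.1 (hr h)).2
  have hdisj : ∀ t t', t ≠ t' → ∀ q ∈ S t, ∀ q' ∈ S t', Disjoint (c4Arcs q) (c4Arcs q') := by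
    intro t t' htt q hq q' hq'
    rw [Finset.disjoint_left]
    intro x hx hx'
    rw [mem_c4Arcs] at hx hx'
    apply htt
    have hrow : ∀ t, ∀ q ∈ S t, (x.1 = q.1 ∨ x.1 = q.2.1) → ∃ i, r (t, i) = x.1 := by
      rintro t q hq (h | h) <;> rw [h]
      · exact (hS₃ t q hq).1
      · exact (hS₃ t q hq).2
    obtain ⟨i, hi⟩ := hrow t q hq hx.1
    obtain ⟨j, hj⟩ := hrow t' q' hq' hx'.1
    exact (Prod.ext_iff.1 (hr (hi.trans hj.symm))).1
  refine ⟨univ.biUnion S, ?_, ?_, ?_⟩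
  · intro q hq
    obtain ⟨t, -, hq⟩ := Finset.mem_biUnion.1 hq
    exact hS₁ t q hq
  · intro q hq q' hq' hne
    obtain ⟨t, -, hq⟩ := Finset.mem_biUnion.1 hq
    obtain ⟨t', -, hq'⟩ := Finset.mem_biUnion.1 hq'
    by_cases h : t = t'
    · subst h
      exact hS₂ t q hq q' hq' hne
    · exact hdisj t t' h q hq q' hq'
  · rw [Finset.card_biUnion]
    · push_cast
      have h1 := Finset.sum_le_sum fun t (_ : t ∈ univ) => hS t
      refine le_trans ?_ h1
      simp only [Finset.sum_sub_distrib, ← Finset.sum_div, Finset.sum_const, Finset.card_univ,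
        Fintype.card_fin, nsmul_eq_mul]
      linarith
    · intro t _ t' _ htt
      change Disjoint (S t) (S t')
      rw [Finset.disjoint_left]
      intro q hq hq'
      have h1 := hdisj t t' htt q hq q hq'
      rw [disjoint_self, Finset.bot_eq_empty] at h1
      have h2 : (q.1, q.2.2.1) ∈ c4Arcs q := by simp [c4Arcs]
      simp [h1] at h2

end C4Packing

/-- For every `ε > 0` there exists `N` such that for all even integers `m, n` with
`min{m,n} ≥ N`, every Eulerian orientation of `K_{m,n}` contains at least
`(1/(4+√8))·mn·(1−ε)` pairwise arc-disjoint directed 4-cycles. -/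
theorem packing_C4_eulerian_bipartite :
    ∀ ε : ℝ, 0 < ε → ∃ N : ℕ, ∀ m n : ℕ, Even m → Even n → N ≤ min m n →
      ∀ o : Fin m → Fin n → Bool, IsEulerianBip o →
        ∃ S : Finset (Fin m × Fin m × Fin n × Fin n),
          (∀ q ∈ S, IsDirC4 o q) ∧
          (∀ q ∈ S, ∀ q' ∈ S, q ≠ q' → Disjoint (c4Arcs q) (c4Arcs q')) ∧
          (1 / (4 + Real.sqrt 8)) * m * n * (1 - ε) ≤ S.card := by
  intro ε hε
  refine ⟨40000000, fun m n _ _ hmn o ho => ?_⟩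
  obtain ⟨hm, hn⟩ := le_min_iff.1 hmn
  obtain ⟨S, hS₁, hS₂, hS⟩ := C4Packing.exists_packing (by omega) o ho
  refine ⟨S, hS₁, hS₂, le_trans ?_ hS⟩
  have hm' : (40000000 : ℝ) ≤ m := by exact_mod_cast hm
  have hn' : (40000000 : ℝ) ≤ n := by exact_mod_cast hn
  have hdiv : (m : ℝ) / 8 - 1 ≤ (m / 8 : ℕ) := by
    have := Nat.lt_floor_add_one ((m : ℝ) / 8)
    have h8 : ⌊(m : ℝ) / 8⌋₊ = m / 8 := by exact_mod_cast Nat.floor_div_eq_div (K := ℝ) m 8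
    rw [h8] at this
    linarith
  have hsqrt : (2.828 : ℝ) ≤ Real.sqrt 8 := Real.le_sqrt_of_sq_le (by norm_num)
  have hc : 1 / (4 + Real.sqrt 8) ≤ 0.1465 := by
    rw [div_le_iff₀ (by positivity)]
    linarith
  have hmn0 : (0 : ℝ) ≤ m * n := by positivity
  calc 1 / (4 + Real.sqrt 8) * m * n * (1 - ε)
      ≤ 1 / (4 + Real.sqrt 8) * m * n * 1 := by gcongr; linarith
    _ = 1 / (4 + Real.sqrt 8) * (m * n) := by ring
    _ ≤ 0.1465 * (m * n) := by gcongr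
    _ ≤ ((m : ℝ) / 8 - 1) * (6 / 5 * n - 16384) := by nlinarith
    _ ≤ (m / 8 : ℕ) * (6 / 5 * n - 16384 : ℝ) := by
      gcongr
      linarith
end

section
/- For every ε > 0 there exists N such that for every odd integer n ≥ N, every regular tournament on n vertices contains at least (1/(8+√32))·n²·(1−ε) pairwise arc-disjoint directed 4-cycles. -/
open Finset

/-- A tournament on `n` vertices: `o u v = true` means there is an arc from `u` to `v`.
Between any two distinct vertices there is exactly one arc, and there are no loops. -/
def IsTournament {n : ℕ} (o : Fin n → Fin n → Bool) : Prop :=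
  (∀ v : Fin n, o v v = false) ∧ ∀ u v : Fin n, u ≠ v → o u v = !o v u

/-- A regular tournament: every vertex has outdegree (and hence indegree) `(n-1)/2`. -/
def IsRegularTournament {n : ℕ} (o : Fin n → Fin n → Bool) : Prop :=
  IsTournament o ∧ ∀ v : Fin n, 2 * (univ.filter fun w : Fin n => o v w = true).card = n - 1

/-- A quadruple `(a, b, c, d)` of four distinct vertices encodes the directed
4-cycle `a → b → c → d → a` in the tournament `o`. -/
def IsDirC4T {n : ℕ} (o : Fin n → Fin n → Bool) (q : Fin n × Fin n × Fin n × Fin n) : Prop :=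
  q.1 ≠ q.2.1 ∧ q.1 ≠ q.2.2.1 ∧ q.1 ≠ q.2.2.2 ∧
  q.2.1 ≠ q.2.2.1 ∧ q.2.1 ≠ q.2.2.2 ∧ q.2.2.1 ≠ q.2.2.2 ∧
  o q.1 q.2.1 = true ∧ o q.2.1 q.2.2.1 = true ∧
  o q.2.2.1 q.2.2.2 = true ∧ o q.2.2.2 q.1 = true

/-- The four arcs of the directed 4-cycle encoded by `q`. -/
def c4ArcsT {n : ℕ} (q : Fin n × Fin n × Fin n × Fin n) : Finset (Fin n × Fin n) :=
  {(q.1, q.2.1), (q.2.1, q.2.2.1), (q.2.2.1, q.2.2.2), (q.2.2.2, q.1)}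

/-- Exponential moment bound: for a uniformly random `ℓ : V → Fin Q`, the number of `v ∈ S` with
`ℓ v = g v` has exponential moment at most `exp ((t + t ^ 2) * #S / Q)`. -/
theorem sum_exp_mul_card_agree_le {V : Type*} [Fintype V] [DecidableEq V] {Q : ℕ} (hQ : 0 < Q)
    (S : Finset V) (g : V → Fin Q) {t : ℝ} (ht : |t| ≤ 1) :
    ∑ ℓ : V → Fin Q, Real.exp (t * #{v ∈ S | ℓ v = g v}) ≤
      (Q : ℝ) ^ Fintype.card V * Real.exp ((t + t ^ 2) * (#S / Q)) := by
  have hQ' : (0 : ℝ) < Q := by exact_mod_cast hQ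
  have key : ∀ ℓ : V → Fin Q, Real.exp (t * #{v ∈ S | ℓ v = g v}) =
      ∏ v, if v ∈ S ∧ ℓ v = g v then Real.exp t else 1 := by
    intro ℓ
    rw [Finset.prod_ite, Finset.prod_const_one, mul_one, Finset.prod_const, ← Real.exp_nat_mul,
      mul_comm]
    congr 4
    ext v
    simp
  have hsum : ∀ v, ∑ j : Fin Q, (if v ∈ S ∧ j = g v then Real.exp t else 1) ≤
      Q * if v ∈ S then Real.exp ((t + t ^ 2) / Q) else 1 := by
    intro v
    by_cases hv : v ∈ S
    · have h1 : ∑ j : Fin Q, (if j = g v then Real.exp t else 1) = Q + (Real.exp t - 1) := by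
        have : ∀ j : Fin Q, (if j = g v then Real.exp t else (1 : ℝ)) =
            1 + if j = g v then Real.exp t - 1 else 0 := by
          intro j; split_ifs <;> ring
        simp [this, Finset.sum_add_distrib]
      simp only [hv, true_and, if_true, h1]
      have h2 := (abs_le.1 (Real.abs_exp_sub_one_sub_id_le ht)).2
      have h3 := Real.add_one_le_exp ((t + t ^ 2) / Q)
      calc (Q : ℝ) + (Real.exp t - 1) ≤ Q + (t + t ^ 2) := by linarith
        _ = Q * ((t + t ^ 2) / Q + 1) := by field_simp; ring
        _ ≤ _ := by gcongr
    · simp [hv]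
  calc ∑ ℓ : V → Fin Q, Real.exp (t * #{v ∈ S | ℓ v = g v})
      = ∏ v, ∑ j : Fin Q, (if v ∈ S ∧ j = g v then Real.exp t else 1) := by
        rw [Finset.prod_univ_sum, Fintype.piFinset_univ]
        exact Finset.sum_congr rfl fun ℓ _ => key ℓ
    _ ≤ ∏ v, (Q * if v ∈ S then Real.exp ((t + t ^ 2) / Q) else 1) := by
        refine Finset.prod_le_prod (fun v _ => Finset.sum_nonneg fun j _ => ?_) fun v _ => hsum v
        split_ifs <;> positivity
    _ = _ := by
        rw [Finset.prod_mul_distrib, Finset.prod_const, Finset.card_univ]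
        congr 1
        rw [Finset.prod_ite, Finset.prod_const_one, mul_one, Finset.prod_const,
          ← Real.exp_nat_mul]
        simp
        ring

/-- Some `ℓ : V → Fin Q` agrees on each of the sets `S i` with the prescribed function `g i` about
as often as a random one. -/
theorem exists_forall_abs_card_agree_sub_le {V ι : Type*} [Fintype V] [DecidableEq V] [Fintype ι]
    {Q : ℕ} (hQ : 0 < Q) (S : ι → Finset V) (g : ι → V → Fin Q) {δ : ℝ} (hδ : 0 < δ) (hδ1 : δ ≤ 1)
    (h : 2 * (Fintype.card ι : ℝ) ≤ Real.exp (δ ^ 2 / 4 * (Fintype.card V / Q))) :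
    ∃ ℓ : V → Fin Q, ∀ i,
      |(#{v ∈ S i | ℓ v = g i v} : ℝ) - #(S i) / Q| ≤ δ * (Fintype.card V / Q) := by
  have : Nonempty (Fin Q) := ⟨⟨0, hQ⟩⟩
  have hQ' : (0 : ℝ) < Q := by exact_mod_cast hQ
  set N : ℝ := Fintype.card V / Q with hN
  have hN0 : 0 ≤ N := by positivity
  set X : (V → Fin Q) → ι → ℝ := fun ℓ i => (#{v ∈ S i | ℓ v = g i v} : ℝ) - #(S i) / Q with hX
  have tail : ∀ i, ∀ t : ℝ, |t| ≤ 1 → ∑ ℓ, Real.exp (t * X ℓ i) ≤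
      (Q : ℝ) ^ Fintype.card V * Real.exp (t ^ 2 * N) := by
    intro i t ht
    have h1 := sum_exp_mul_card_agree_le hQ (S i) (g i) ht
    have h2 : ∀ ℓ, Real.exp (t * X ℓ i) =
        Real.exp (-(t * (#(S i) / Q))) * Real.exp (t * #{v ∈ S i | ℓ v = g i v}) := by
      intro ℓ
      rw [← Real.exp_add]
      congr 1
      simp only [hX]
      ring
    calc ∑ ℓ, Real.exp (t * X ℓ i)
        = Real.exp (-(t * (#(S i) / Q))) * ∑ ℓ : V → Fin Q,
            Real.exp (t * #{v ∈ S i | ℓ v = g i v}) := by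
          rw [Finset.mul_sum]
          exact Finset.sum_congr rfl fun ℓ _ => h2 ℓ
      _ ≤ Real.exp (-(t * (#(S i) / Q))) *
            ((Q : ℝ) ^ Fintype.card V * Real.exp ((t + t ^ 2) * (#(S i) / Q))) := by gcongr
      _ = (Q : ℝ) ^ Fintype.card V * Real.exp (t ^ 2 * (#(S i) / Q)) := by
          rw [mul_left_comm, ← Real.exp_add]
          ring_nf
      _ ≤ _ := by
          rw [hN]
          gcongr
          exact Finset.card_le_univ _
  have hδ2 : |δ / 2| ≤ 1 := by rw [abs_of_pos (by positivity)]; linarith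
  obtain ⟨ℓ, -, hℓ⟩ := Finset.exists_le_of_sum_le (s := (univ : Finset (V → Fin Q)))
    (f := fun ℓ => ∑ i, (Real.exp (δ / 2 * X ℓ i) + Real.exp (-(δ / 2) * X ℓ i)))
    (g := fun _ => 2 * (Fintype.card ι : ℝ) * Real.exp ((δ / 2) ^ 2 * N))
    Finset.univ_nonempty (by
      rw [Finset.sum_comm]
      calc ∑ i, ∑ ℓ, (Real.exp (δ / 2 * X ℓ i) + Real.exp (-(δ / 2) * X ℓ i))
          ≤ ∑ i : ι, 2 * ((Q : ℝ) ^ Fintype.card V * Real.exp ((δ / 2) ^ 2 * N)) := by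
            refine Finset.sum_le_sum fun i _ => ?_
            rw [Finset.sum_add_distrib]
            have h1 := tail i (δ / 2) hδ2
            have h2 := tail i (-(δ / 2)) (by rwa [abs_neg])
            rw [neg_sq] at h2
            linarith
        _ ≤ _ := by
            simp
            apply le_of_eq
            ring)
  refine ⟨ℓ, fun i => ?_⟩
  by_contra! hlt
  change δ * N < |X ℓ i| at hlt
  have h1 : Real.exp (δ / 2 * |X ℓ i|) <
      Real.exp (δ / 2 * X ℓ i) + Real.exp (-(δ / 2) * X ℓ i) := by
    rcases abs_cases (X ℓ i) with ⟨h, -⟩ | ⟨h, -⟩ <;> rw [h]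
    · linarith [Real.exp_pos (-(δ / 2) * X ℓ i)]
    · rw [mul_neg, ← neg_mul]
      linarith [Real.exp_pos (δ / 2 * X ℓ i)]
  have h2 : Real.exp (δ / 2 * X ℓ i) + Real.exp (-(δ / 2) * X ℓ i) ≤
      ∑ i, (Real.exp (δ / 2 * X ℓ i) + Real.exp (-(δ / 2) * X ℓ i)) :=
    Finset.single_le_sum (f := fun i => Real.exp (δ / 2 * X ℓ i) + Real.exp (-(δ / 2) * X ℓ i))
      (fun i _ => by positivity) (Finset.mem_univ i)
  have h3 : 2 * (Fintype.card ι : ℝ) * Real.exp ((δ / 2) ^ 2 * N) ≤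
      Real.exp (δ / 2 * (δ * N)) := by
    calc _ ≤ Real.exp (δ ^ 2 / 4 * N) * Real.exp ((δ / 2) ^ 2 * N) := by gcongr
      _ = _ := by rw [← Real.exp_add]; ring_nf
  have h4 : Real.exp (δ / 2 * (δ * N)) ≤ Real.exp (δ / 2 * |X ℓ i|) := by gcongr
  linarith

theorem Finset.exists_injOn_range_card {α : Type*} [Nonempty α] (s : Finset α) :
    ∃ f : ℕ → α, (∀ t < #s, f t ∈ s) ∧ ∀ t < #s, ∀ t' < #s, f t = f t' → t = t' := by
  classical
  refine ⟨fun t => if h : t < #s then (s.equivFin.symm ⟨t, h⟩ : α) else Classical.arbitrary α,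
    fun t ht => by simp [ht], fun t ht t' ht' h => ?_⟩
  simpa [ht, ht', Subtype.ext_iff] using h

theorem Finset.sum_sum_eq_two_mul_sum_lt {α : Type*} [Fintype α] [LinearOrder α] (M : α → α → ℕ)
    (hM : ∀ a b, M a b = M b a) (hM0 : ∀ a, M a a = 0) :
    ∑ a, ∑ b, M a b = 2 * ∑ p : α × α with p.1 < p.2, M p.1 p.2 := by
  have h1 : ∀ a b, M a b = (if a < b then M a b else 0) + (if b < a then M b a else 0) := by
    intro a b
    rcases lt_trichotomy a b with h | rfl | h
    · simp [h, h.le]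
    · simp [hM0]
    · simp [h, h.le, hM a b]
  have h2 : ∑ p : α × α with p.1 < p.2, M p.1 p.2 = ∑ a, ∑ b, if a < b then M a b else 0 := by
    rw [Finset.sum_filter, Fintype.sum_prod_type]
  rw [h2, two_mul]
  nth_rw 3 [Finset.sum_comm]
  simp only [← Finset.sum_add_distrib]
  exact Finset.sum_congr rfl fun a _ => Finset.sum_congr rfl fun b _ => h1 a b

/-- A family of arc-disjoint directed 2-paths `a → v → b`, `v ∈ P a b`, in a tournament yields
arc-disjoint directed 4-cycles by pairing the paths from `a` to `b` with those from `b` to `a`. -/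
theorem IsTournament.exists_packing_of_paths {n : ℕ} {o : Fin n → Fin n → Bool}
    (ho : IsTournament o) (P : Fin n → Fin n → Finset (Fin n))
    (hP : ∀ a b, ∀ v ∈ P a b, o a v = true ∧ o v b = true)
    (hR : ∀ a b b', ∀ v ∈ P a b, v ∈ P a b' → b = b')
    (hL : ∀ a a' b, ∀ v ∈ P a b, v ∈ P a' b → a = a')
    (hX : ∀ a b c, ∀ v ∈ P a b, a ∉ P c v) :
    ∃ S : Finset (Fin n × Fin n × Fin n × Fin n),
      (∀ q ∈ S, IsDirC4T o q) ∧
      (∀ q ∈ S, ∀ q' ∈ S, q ≠ q' → Disjoint (c4ArcsT q) (c4ArcsT q')) ∧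
      ∑ a, ∑ b, min #(P a b) #(P b a) = 2 * #S := by
  rcases isEmpty_or_nonempty (Fin n) with hn | hn
  · exact ⟨∅, by simp⟩
  have asymm : ∀ a b, o a b = true → o b a = true → False := by
    intro a b h1 h2
    by_cases hab : a = b
    · subst hab; simp [ho.1] at h1
    · have := ho.2 a b hab
      simp [h1, h2] at this
  choose e heP heI using fun a b => (P a b).exists_injOn_range_card
  let I : Finset (Σ _ : Fin n × Fin n, ℕ) :=
    ({p : Fin n × Fin n | p.1 < p.2} : Finset _).sigma
      fun p => range (min #(P p.1 p.2) #(P p.2 p.1))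
  let φ : (Σ _ : Fin n × Fin n, ℕ) → Fin n × Fin n × Fin n × Fin n :=
    fun i => (i.1.1, e i.1.1 i.1.2 i.2, i.1.2, e i.1.2 i.1.1 i.2)
  have hI : ∀ a b t, (⟨(a, b), t⟩ : Σ _ : Fin n × Fin n, ℕ) ∈ I ↔
      a < b ∧ t < #(P a b) ∧ t < #(P b a) := by
    intro a b t
    simp [I]
  have hφ : Set.InjOn φ I := by
    rintro ⟨⟨a, b⟩, t⟩ h ⟨⟨a', b'⟩, t'⟩ h' heq
    have h := (hI _ _ _).1 h
    have h' := (hI _ _ _).1 h'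
    simp only [φ, Prod.mk.injEq] at heq
    obtain ⟨rfl, h2, rfl, -⟩ := heq
    rw [heI _ _ _ h.2.1 _ h'.2.1 h2]
  refine ⟨I.image φ, ?_, ?_, ?_⟩
  · simp only [Finset.mem_image]
    rintro _ ⟨⟨⟨a, b⟩, t⟩, h, rfl⟩
    obtain ⟨hab, h1, h2⟩ := (hI _ _ _).1 h
    obtain ⟨h3, h4⟩ := hP _ _ _ (heP _ _ _ h1)
    obtain ⟨h5, h6⟩ := hP _ _ _ (heP _ _ _ h2)
    simp only [IsDirC4T, φ]
    refine ⟨?_, hab.ne, ?_, ?_, ?_, ?_, h3, h4, h5, h6⟩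
    · intro h; rw [← h, ho.1] at h3; simp at h3
    · intro h; rw [← h, ho.1] at h6; simp at h6
    · intro h; rw [h, ho.1] at h4; simp at h4
    · intro h; rw [← h] at h5; exact asymm _ _ h4 h5
    · intro h; rw [← h, ho.1] at h5; simp at h5
  · simp only [Finset.mem_image]
    rintro _ ⟨⟨⟨a, b⟩, t⟩, h, rfl⟩ _ ⟨⟨⟨a', b'⟩, t'⟩, h', rfl⟩ hne
    obtain ⟨hab, h1, h2⟩ := (hI _ _ _).1 h
    obtain ⟨hab', h1', h2'⟩ := (hI _ _ _).1 h'
    have m1 := heP _ _ _ h1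
    have m2 := heP _ _ _ h2
    have m1' := heP _ _ _ h1'
    have m2' := heP _ _ _ h2'
    have hne' : ¬ (a = a' ∧ b = b' ∧ t = t') := by
      rintro ⟨rfl, rfl, rfl⟩; exact hne rfl
    have i1 := heI a b t h1 t'
    have i2 := heI b a t h2 t'
    have hpath : ∀ x v y x' v' y' z w, v ∈ P x y → v' ∈ P x' y' →
        ((z, w) = (x, v) ∨ (z, w) = (v, y)) → ((z, w) = (x', v') ∨ (z, w) = (v', y')) →
        x = x' ∧ v = v' ∧ y = y' := by
      intro x v y x' v' y' z w hv hv' h h'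
      simp only [Prod.mk.injEq] at h h'
      rcases h with ⟨rfl, rfl⟩ | ⟨rfl, rfl⟩ <;> rcases h' with ⟨rfl, rfl⟩ | ⟨rfl, rfl⟩
      · exact ⟨rfl, rfl, hR _ _ _ _ hv hv'⟩
      · exact absurd hv' (hX _ _ _ _ hv)
      · exact absurd hv (hX _ _ _ _ hv')
      · exact ⟨hL _ _ _ _ hv hv', rfl, rfl⟩
    rw [Finset.disjoint_left]
    rintro ⟨z, w⟩ hz hz'
    simp only [c4ArcsT, φ, Finset.mem_insert, Finset.mem_singleton] at hz hz'
    rw [← or_assoc] at hz hz'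
    rcases hz with hz | hz <;> rcases hz' with hz' | hz'
    · obtain ⟨rfl, hv, rfl⟩ := hpath _ _ _ _ _ _ _ _ m1 m1' hz hz'
      exact hne' ⟨rfl, rfl, i1 h1' hv⟩
    · obtain ⟨rfl, hv, rfl⟩ := hpath _ _ _ _ _ _ _ _ m1 m2' hz hz'
      exact lt_asymm hab hab'
    · obtain ⟨rfl, hv, rfl⟩ := hpath _ _ _ _ _ _ _ _ m2 m1' hz hz'
      exact lt_asymm hab hab'
    · obtain ⟨rfl, hv, rfl⟩ := hpath _ _ _ _ _ _ _ _ m2 m2' hz hz'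
      exact hne' ⟨rfl, rfl, i2 h2' hv⟩
  · rw [Finset.card_image_of_injOn hφ, Finset.card_sigma,
      Finset.sum_sum_eq_two_mul_sum_lt (fun a b => min #(P a b) #(P b a))
        (fun a b => min_comm _ _)]
    · simp
    · intro a
      have : P a a = ∅ := Finset.eq_empty_of_forall_notMem fun v hv =>
        asymm a v (hP _ _ _ hv).1 (hP _ _ _ hv).2
      simp [this]

theorem Finset.exists_injOn_fin_of_card_le {α : Type*} {q : ℕ} (hq : 0 < q) (s : Finset α)
    (hs : #s ≤ q) : ∃ f : α → Fin q, Set.InjOn f s := by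
  classical
  refine ⟨fun a => if h : a ∈ s then Fin.castLE hs (s.equivFin ⟨a, h⟩) else ⟨0, hq⟩,
    fun a ha b hb h => ?_⟩
  rw [Finset.mem_coe] at ha hb
  simpa [ha, hb, Fin.ext_iff, ← Fin.ext_iff] using h

/-- The midpoints of the 2-paths from `a` to `b` whose label is larger than that of `a`. -/
def laterMidpoints {n m : ℕ} (o : Fin n → Fin n → Bool) (ℓ : Fin n → Fin m) (a b : Fin n) :
    Finset (Fin n) :=
  {v | o a v = true ∧ o v b = true ∧ ℓ a < ℓ v}

namespace IsRegularTournament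

variable {n : ℕ} {o : Fin n → Fin n → Bool}

theorem two_mul_card_out (ho : IsRegularTournament o) (v : Fin n) :
    2 * (#{w | o v w = true} : ℝ) = n - 1 := by
  have h := ho.2 v
  have hn : 1 ≤ n := v.pos
  have : ((2 * #{w | o v w = true} : ℕ) : ℝ) = ((n - 1 : ℕ) : ℝ) := by rw [h]
  push_cast [hn] at this
  exact this

theorem two_mul_card_in (ho : IsRegularTournament o) (v : Fin n) :
    2 * (#{w | o w v = true} : ℝ) = n - 1 := by
  have h := ho.two_mul_card_out v
  have h1 : #{w | o w v = true} + #{w | ¬ o w v = true} = n := by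
    rw [Finset.card_filter_add_card_filter_not, Finset.card_univ, Fintype.card_fin]
  have h2 : ({w | ¬ o w v = true} : Finset (Fin n)) =
      insert v ({w | o v w = true} : Finset (Fin n)) := by
    ext w
    by_cases hw : w = v
    · subst hw; simp [ho.1.1]
    · have := ho.1.2 v w (Ne.symm hw)
      simp [hw, this]
  rw [h2, Finset.card_insert_of_notMem (by simp [ho.1.1])] at h1
  have h3 : (#{w | o w v = true} : ℝ) + (#{w | o v w = true} + 1) = n := by exact_mod_cast h1
  linarith

/-- In a regular tournament the numbers of 2-paths from `a` to `b` and from `b` to `a` differ by at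
most one. -/
theorem card_paths_le (ho : IsRegularTournament o) (a b : Fin n) :
    #{v | o a v = true ∧ o v b = true} ≤ #{v | o b v = true ∧ o v a = true} + 1 := by
  have ha := ho.2 a
  have hb := ho.2 b
  have h1 : #{v | o a v = true ∧ o v b = true} + #{v | o a v = true ∧ o b v = true} ≤
      #{v | o a v = true} := by
    rw [← Finset.card_union_of_disjoint]
    · apply Finset.card_le_card
      intro v; simp; tauto
    · rw [Finset.disjoint_left]
      intro v
      by_cases hv : v = b
      · subst hv; simp [ho.1.1]
      · simp +contextual [ho.1.2 v b hv]
  have h2 : #{v | o b v = true} ≤ #{v | o b v = true ∧ o v a = true} +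
      #{v | o a v = true ∧ o b v = true} + 1 := by
    refine le_trans (Finset.card_le_card (t := insert a
      (({v | o b v = true ∧ o v a = true} : Finset (Fin n)) ∪
        ({v | o a v = true ∧ o b v = true} : Finset (Fin n)))) ?_)
      ((Finset.card_insert_le _ _).trans (by gcongr; exact Finset.card_union_le _ _))
    intro v
    by_cases hv : v = a
    · simp [hv]
    · have := ho.1.2 v a hv
      simp [hv, this]
      cases o a v <;> simp
  omega

/-- Given a labelling of the vertices for which every vertex has at most `q` in-neighbours and at
most `q` out-neighbours with any given label, one can pack about
`min #(laterMidpoints o ℓ a b) #(laterMidpoints o ℓ b a) / q` directed 4-cycles through each pair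
`a, b` of equally labelled vertices. -/
theorem exists_packing_of_labelling (ho : IsRegularTournament o) {m q : ℕ} (hq : 0 < q)
    (ℓ : Fin n → Fin m) {δ : ℝ} (hδ : 0 < δ) (hδ1 : δ ≤ 1)
    (hin : ∀ v i, #{u | o u v = true ∧ ℓ u = i} ≤ q)
    (hout : ∀ v i, #{u | o v u = true ∧ ℓ u = i} ≤ q)
    (hexp : 2 * (n : ℝ) ^ 2 ≤ Real.exp (δ ^ 2 / 4 * (n / q))) :
    ∃ S : Finset (Fin n × Fin n × Fin n × Fin n),
      (∀ q ∈ S, IsDirC4T o q) ∧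
      (∀ q ∈ S, ∀ q' ∈ S, q ≠ q' → Disjoint (c4ArcsT q) (c4ArcsT q')) ∧
      ∑ a, ∑ b, (if ℓ a = ℓ b then
        min (#(laterMidpoints o ℓ a b) : ℝ) #(laterMidpoints o ℓ b a) / q - δ * (n / q)
        else 0) ≤ 2 * #S := by
  have : NeZero q := ⟨hq.ne'⟩
  choose f hf using fun v i => Finset.exists_injOn_fin_of_card_le hq _ (hin v i)
  choose g hg using fun v i => Finset.exists_injOn_fin_of_card_le hq _ (hout v i)
  obtain ⟨c, hc⟩ := exists_forall_abs_card_agree_sub_le (V := Fin n) (ι := Fin n × Fin n) hq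
    (fun p => laterMidpoints o ℓ p.1 p.2) (fun p v => f v (ℓ p.1) p.1 + g v (ℓ p.2) p.2) hδ hδ1
    (by simpa [sq] using hexp)
  let P : Fin n → Fin n → Finset (Fin n) := fun a b =>
    {v ∈ laterMidpoints o ℓ a b | ℓ a = ℓ b ∧ c v = f v (ℓ a) a + g v (ℓ b) b}
  have hmem : ∀ a b v, v ∈ P a b ↔ (o a v = true ∧ o v b = true ∧ ℓ a < ℓ v) ∧ ℓ a = ℓ b ∧
      c v = f v (ℓ a) a + g v (ℓ b) b := by
    intro a b v
    simp [P, laterMidpoints]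
  obtain ⟨S, hS1, hS2, hS3⟩ := ho.1.exists_packing_of_paths P
    (fun a b v hv => by
      rw [hmem] at hv; exact ⟨hv.1.1, hv.1.2.1⟩)
    (fun a b b' v hv hv' => by
      rw [hmem] at hv hv'
      obtain ⟨⟨-, h1, -⟩, h2, h3⟩ := hv
      obtain ⟨⟨-, h1', -⟩, h2', h3'⟩ := hv'
      rw [h3, ← h2', ← h2, add_right_inj] at h3'
      exact hg v (ℓ a) (by simp [h1, h2]) (by simp [h1', h2']) h3')
    (fun a a' b v hv hv' => by
      rw [hmem] at hv hv'
      obtain ⟨⟨h1, -, -⟩, h2, h3⟩ := hv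
      obtain ⟨⟨h1', -, -⟩, h2', h3'⟩ := hv'
      rw [h3, h2, h2', add_left_inj] at h3'
      exact hf v (ℓ b) (by simp [h1, h2]) (by simp [h1', h2']) h3')
    (fun a b c v hv hv' => by
      rw [hmem] at hv hv'
      have h1 := hv.1.2.2
      have h2 := hv'.1.2.2
      rw [hv'.2.1] at h2
      exact lt_asymm h1 h2)
  refine ⟨S, hS1, hS2, ?_⟩
  have hS4 : ∑ a, ∑ b, min (#(P a b) : ℝ) #(P b a) = 2 * #S := by exact_mod_cast hS3
  rw [← hS4]
  refine Finset.sum_le_sum fun a _ => Finset.sum_le_sum fun b _ => ?_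
  split_ifs with hab
  · have key : ∀ a b, ℓ a = ℓ b →
        (#(laterMidpoints o ℓ a b) : ℝ) / q - δ * (n / q) ≤ #(P a b) := by
      intro a b hab
      have h1 := (abs_le.1 (hc (a, b))).1
      have h2 : P a b = {v ∈ laterMidpoints o ℓ a b | c v = f v (ℓ a) a + g v (ℓ b) b} := by
        simp [P, hab]
      simp only [Fintype.card_fin] at h1
      rw [h2]
      linarith
    apply le_min
    · refine le_trans ?_ (key a b hab)
      gcongr
      exact min_le_left _ _
    · refine le_trans ?_ (key b a hab.symm)
      gcongr
      exact min_le_right _ _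
  · positivity

end IsRegularTournament

/-- The number of 2-paths `a → v → b` with `ℓ a = ℓ b < ℓ v`, counted by their midpoints. -/
theorem sum_sum_card_paths_eq {n m : ℕ} (o : Fin n → Fin n → Bool) (ℓ : Fin n → Fin m) :
    ∑ a, ∑ b, (if ℓ a = ℓ b then #{v | o a v = true ∧ o v b = true ∧ ℓ a < ℓ v} else 0) =
      ∑ v, ∑ i with i < ℓ v,
        #{u | o u v = true ∧ ℓ u = i} * #{u | o v u = true ∧ ℓ u = i} := by
  have h1 : ∀ v, ∑ i with i < ℓ v,
      #{u | o u v = true ∧ ℓ u = i} * #{u | o v u = true ∧ ℓ u = i} =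
      ∑ a, ∑ b, if ℓ a = ℓ b then
        (if o a v = true ∧ o v b = true ∧ ℓ a < ℓ v then 1 else 0) else 0 := by
    intro v
    simp only [Finset.card_filter, Finset.sum_mul_sum]
    rw [Finset.sum_comm]
    refine Finset.sum_congr rfl fun a _ => ?_
    rw [Finset.sum_comm]
    refine Finset.sum_congr rfl fun b _ => ?_
    rw [Finset.sum_filter, Finset.sum_eq_single (ℓ a)]
    · by_cases hab : ℓ a = ℓ b
      · simp [hab]; split_ifs <;> simp_all
      · simp [hab, Ne.symm hab]
    · intro i _ hi
      simp [Ne.symm hi]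
    · simp
  simp only [h1]
  rw [Finset.sum_comm]
  simp only [Finset.card_filter]
  rw [Finset.sum_comm]
  symm
  rw [Finset.sum_comm]
  refine Finset.sum_congr rfl fun a _ => ?_
  rw [Finset.sum_comm]
  refine Finset.sum_congr rfl fun b _ => ?_
  split_ifs <;> simp

/-- A labelling with classes of size at least `C` has label sum at least `C * m * (m - 1) / 2`. -/
theorem le_sum_label {n m : ℕ} (ℓ : Fin n → Fin m) {C : ℝ}
    (hC : ∀ i, C ≤ #{v | ℓ v = i}) : C * (m * (m - 1) / 2) ≤ ∑ v, ((ℓ v : ℕ) : ℝ) := by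
  have h1 : ∑ v, ((ℓ v : ℕ) : ℝ) = ∑ i : Fin m, (#{v | ℓ v = i} : ℝ) * (i : ℕ) := by
    rw [← Finset.sum_fiberwise_of_maps_to (g := ℓ) (t := univ) (by simp)]
    refine Finset.sum_congr rfl fun i _ => ?_
    rw [← nsmul_eq_mul, ← Finset.sum_const]
    refine Finset.sum_congr rfl fun v hv => ?_
    rw [(Finset.mem_filter.1 hv).2]
  have h2 : (m * (m - 1) / 2 : ℝ) = ∑ i : Fin m, ((i : ℕ) : ℝ) := by
    have gauss : ∀ k : ℕ, (k * (k - 1) / 2 : ℝ) = ∑ i ∈ range k, (i : ℝ) := by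
      intro k
      induction k with
      | zero => simp
      | succ k ih =>
        rw [Finset.sum_range_succ, ← ih]
        push_cast
        ring
    rw [Fin.sum_univ_eq_sum_range (fun i => (i : ℝ)) m, gauss]
  rw [h1, h2, Finset.mul_sum]
  gcongr with i
  exact hC i

/-- If the classes of the labelling have sizes between `C` and `C'`, and every vertex has at least
`L` in- and out-neighbours with any given label, then the numbers of 2-paths that can be closed up
to 4-cycles add up to roughly `C * (m * (m - 1) / 2) * L ^ 2`. -/
theorem le_sum_sum_min {n m : ℕ} (o : Fin n → Fin n → Bool) (ℓ : Fin n → Fin m)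
    {C C' L E F q : ℝ} (hL : 0 ≤ L) (hE : 0 ≤ E) (hF : 0 ≤ F) (hq : 0 < q)
    (hC : ∀ i, C ≤ #{v | ℓ v = i}) (hC' : ∀ i, (#{v | ℓ v = i} : ℝ) ≤ C')
    (hin : ∀ v i, L ≤ #{u | o u v = true ∧ ℓ u = i})
    (hout : ∀ v i, L ≤ #{u | o v u = true ∧ ℓ u = i})
    (hTT : ∀ a b, ℓ a = ℓ b → (#(laterMidpoints o ℓ a b) : ℝ) ≤ #(laterMidpoints o ℓ b a) + E) :
    C * (m * (m - 1) / 2) * L ^ 2 / q - m * C' ^ 2 * (E / q + F) ≤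
      ∑ a, ∑ b, (if ℓ a = ℓ b then
        min (#(laterMidpoints o ℓ a b) : ℝ) #(laterMidpoints o ℓ b a) / q - F else 0) := by
  have h1 : ∀ a b, (if ℓ a = ℓ b then (#(laterMidpoints o ℓ a b) : ℝ) else 0) / q -
      (if ℓ a = ℓ b then 1 else 0) * (E / q + F) ≤
      if ℓ a = ℓ b then
        min (#(laterMidpoints o ℓ a b) : ℝ) #(laterMidpoints o ℓ b a) / q - F else 0 := by
    intro a b
    split_ifs with hab
    · have : (#(laterMidpoints o ℓ a b) : ℝ) - E ≤
          min (#(laterMidpoints o ℓ a b) : ℝ) #(laterMidpoints o ℓ b a) :=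
        le_min (by linarith) (by linarith [hTT a b hab])
      have : ((#(laterMidpoints o ℓ a b) : ℝ) - E) / q ≤
          min (#(laterMidpoints o ℓ a b) : ℝ) #(laterMidpoints o ℓ b a) / q := by gcongr
      rw [sub_div] at this
      linarith
    · simp
  refine le_trans ?_ (Finset.sum_le_sum fun a _ => Finset.sum_le_sum fun b _ => h1 a b)
  simp only [Finset.sum_sub_distrib, ← Finset.sum_mul, ← Finset.sum_div]
  have h2 : ∑ a, ∑ b, (if ℓ a = ℓ b then (#(laterMidpoints o ℓ a b) : ℝ) else 0) =
      ∑ v, ∑ i with i < ℓ v,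
        (#{u | o u v = true ∧ ℓ u = i} : ℝ) * #{u | o v u = true ∧ ℓ u = i} := by
    simp only [laterMidpoints]
    exact_mod_cast sum_sum_card_paths_eq o ℓ
  have h3 : C * (m * (m - 1) / 2) * L ^ 2 ≤
      ∑ a, ∑ b, (if ℓ a = ℓ b then (#(laterMidpoints o ℓ a b) : ℝ) else 0) := by
    rw [h2]
    calc C * (m * (m - 1) / 2) * L ^ 2 ≤ (∑ v, ((ℓ v : ℕ) : ℝ)) * L ^ 2 := by
          gcongr
          exact le_sum_label ℓ hC
      _ = ∑ v, ∑ i with i < ℓ v, L ^ 2 := by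
          rw [Finset.sum_mul]
          refine Finset.sum_congr rfl fun v _ => ?_
          have : ({i | i < ℓ v} : Finset (Fin m)) = Finset.Iio (ℓ v) := by ext; simp
          rw [Finset.sum_const, nsmul_eq_mul, this, Fin.card_Iio]
      _ ≤ _ := by
          refine Finset.sum_le_sum fun v _ => Finset.sum_le_sum fun i _ => ?_
          rw [sq]
          exact mul_le_mul (hin v i) (hout v i) hL (by positivity)
  have h4 : ∑ a, ∑ b, (if ℓ a = ℓ b then (1 : ℝ) else 0) ≤ m * C' ^ 2 := by
    calc ∑ a, ∑ b, (if ℓ a = ℓ b then (1 : ℝ) else 0)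
        = ∑ a, (#{b | ℓ b = ℓ a} : ℝ) := by
          refine Finset.sum_congr rfl fun a _ => ?_
          simp [eq_comm]
      _ = ∑ i : Fin m, (#{b | ℓ b = i} : ℝ) ^ 2 := by
          rw [← Finset.sum_fiberwise_of_maps_to (g := ℓ) (t := univ) (by simp)]
          refine Finset.sum_congr rfl fun i _ => ?_
          rw [sq, ← nsmul_eq_mul, ← Finset.sum_const]
          refine Finset.sum_congr rfl fun v hv => ?_
          rw [(Finset.mem_filter.1 hv).2]
      _ ≤ ∑ i : Fin m, C' ^ 2 := by
          gcongr with i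
          exact hC' i
      _ = m * C' ^ 2 := by simp
  gcongr

/-- A labelling with `m` labels for which every label occurs about the expected number of times
among all vertices, in every in- and out-neighbourhood, and among the midpoints of the 2-paths
joining any two vertices. -/
theorem exists_balanced_labelling {n m : ℕ} (o : Fin n → Fin n → Bool) (hm : 0 < m) {δ : ℝ}
    (hδ : 0 < δ) (hδ1 : δ ≤ 1)
    (h : 2 * ((n + 1 : ℝ) ^ 2 * m) ≤ Real.exp (δ ^ 2 / 4 * (n / m))) :
    ∃ ℓ : Fin n → Fin m,
      (∀ i, |(#{v | ℓ v = i} : ℝ) - n / m| ≤ δ * (n / m)) ∧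
      (∀ v i, |(#{u | o u v = true ∧ ℓ u = i} : ℝ) - #{u | o u v = true} / m| ≤ δ * (n / m)) ∧
      (∀ v i, |(#{u | o v u = true ∧ ℓ u = i} : ℝ) - #{u | o v u = true} / m| ≤ δ * (n / m)) ∧
      ∀ a b i, |(#{v | (o a v = true ∧ o v b = true) ∧ ℓ v = i} : ℝ) -
        #{v | o a v = true ∧ o v b = true} / m| ≤ δ * (n / m) := by
  obtain ⟨ℓ, hℓ⟩ := exists_forall_abs_card_agree_sub_le (V := Fin n)
    (ι := (Option (Fin n) × Option (Fin n)) × Fin m) hm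
    (fun p => {v | (∀ a ∈ p.1.1, o a v = true) ∧ ∀ b ∈ p.1.2, o v b = true})
    (fun p _ => p.2) hδ hδ1 (by simpa [sq] using h)
  simp only [Finset.filter_filter, Fintype.card_fin] at hℓ
  refine ⟨ℓ, fun i => ?_, fun v i => ?_, fun v i => ?_, fun a b i => ?_⟩
  · simpa using hℓ ((none, none), i)
  · simpa using hℓ ((none, some v), i)
  · simpa using hℓ ((some v, none), i)
  · simpa using hℓ ((some a, some b), i)

/-- If a labelling splits the midpoints of 2-paths between any two vertices evenly up to an error
`D`, then `laterMidpoints o ℓ` is nearly symmetric on equally labelled vertices. -/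
theorem IsRegularTournament.card_laterMidpoints_le {n m : ℕ} {o : Fin n → Fin n → Bool}
    (ho : IsRegularTournament o) (ℓ : Fin n → Fin m) {D : ℝ} (hD : 0 ≤ D)
    (h : ∀ a b i, |(#{v | (o a v = true ∧ o v b = true) ∧ ℓ v = i} : ℝ) -
        #{v | o a v = true ∧ o v b = true} / m| ≤ D) (a b : Fin n) (hab : ℓ a = ℓ b) :
    (#(laterMidpoints o ℓ a b) : ℝ) ≤ #(laterMidpoints o ℓ b a) + (2 * m * D + 1) := by
  have hm : (0 : ℝ) < m := by exact_mod_cast (ℓ a).pos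
  have key : ∀ a b, #(laterMidpoints o ℓ a b) =
      ∑ i with ℓ a < i, #{v | (o a v = true ∧ o v b = true) ∧ ℓ v = i} := by
    intro a b
    rw [Finset.card_eq_sum_card_fiberwise (f := ℓ) (t := ({i | ℓ a < i} : Finset (Fin m)))]
    · refine Finset.sum_congr rfl fun i hi => ?_
      rw [Finset.mem_filter] at hi
      congr 1
      ext v
      simp only [laterMidpoints, Finset.mem_filter, Finset.mem_univ, true_and]
      constructor
      · rintro ⟨⟨h1, h2, -⟩, h3⟩; exact ⟨⟨h1, h2⟩, h3⟩
      · rintro ⟨⟨h1, h2⟩, h3⟩; exact ⟨⟨h1, h2, h3 ▸ hi.2⟩, h3⟩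
    · intro v hv
      simp_all [laterMidpoints]
  have hd : (#{v | o a v = true ∧ o v b = true} : ℝ) ≤
      #{v | o b v = true ∧ o v a = true} + 1 := by exact_mod_cast ho.card_paths_le a b
  have hd' := div_le_div_of_nonneg_right hd hm.le
  rw [add_div] at hd'
  rw [key a b, key b a, ← hab]
  push_cast
  calc ∑ i with ℓ a < i, (#{v | (o a v = true ∧ o v b = true) ∧ ℓ v = i} : ℝ)
      ≤ ∑ i with ℓ a < i, ((#{v | (o b v = true ∧ o v a = true) ∧ ℓ v = i} : ℝ) +
          (2 * D + 1 / m)) := by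
        refine Finset.sum_le_sum fun i _ => ?_
        have h1 := (abs_le.1 (h a b i)).2
        have h2 := (abs_le.1 (h b a i)).1
        linarith
    _ ≤ _ := by
        rw [Finset.sum_add_distrib, Finset.sum_const, nsmul_eq_mul]
        gcongr
        have h3 : (#{i | ℓ a < i} : ℝ) ≤ m := by
          exact_mod_cast (Finset.card_le_univ _).trans_eq (Fintype.card_fin m)
        calc (#{i | ℓ a < i} : ℝ) * (2 * D + 1 / m) ≤ m * (2 * D + 1 / m) := by gcongr
          _ = 2 * m * D + 1 := by field_simp

/-- A regular tournament on `n` vertices, `n` large, has at least `n ^ 2 / 13` arc-disjoint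
directed 4-cycles. -/
theorem IsRegularTournament.exists_packing {n m : ℕ} {o : Fin n → Fin n → Bool}
    (ho : IsRegularTournament o) (hm : 1000 ≤ m) (hmn : m * m ≤ n) (hnm : n < (m + 1) * (m + 1))
    (hexp : 2 * ((m : ℝ) + 1) ^ 5 ≤ Real.exp ((1 / 200) ^ 2 / 4 * m)) :
    ∃ S : Finset (Fin n × Fin n × Fin n × Fin n),
      (∀ q ∈ S, IsDirC4T o q) ∧
      (∀ q ∈ S, ∀ q' ∈ S, q ≠ q' → Disjoint (c4ArcsT q) (c4ArcsT q')) ∧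
      (n : ℝ) ^ 2 / 13 ≤ #S := by
  have hm' : (1000 : ℝ) ≤ m := by exact_mod_cast hm
  have hm0 : (0 : ℝ) < m := by linarith
  have hmn' : (m : ℝ) * m ≤ n := by exact_mod_cast hmn
  have hnm' : (n : ℝ) + 1 ≤ (m + 1) * (m + 1) := by exact_mod_cast hnm
  obtain ⟨s, hs⟩ : ∃ s : ℝ, s = n / m := ⟨_, rfl⟩
  have hns : (n : ℝ) = m * s := by rw [hs]; field_simp
  have hsm : (m : ℝ) ≤ s := by rw [hs, le_div_iff₀ hm0]; exact hmn'
  have hs0 : 0 < s := by linarith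
  have hfam : 2 * ((n + 1 : ℝ) ^ 2 * m) ≤ 2 * ((m : ℝ) + 1) ^ 5 := by
    calc 2 * ((n + 1 : ℝ) ^ 2 * m) ≤ 2 * (((m + 1) * (m + 1)) ^ 2 * (m + 1)) := by
          gcongr; linarith
      _ = _ := by ring
  obtain ⟨ℓ, h1, h2, h3, h4⟩ := exists_balanced_labelling o (by omega : 0 < m)
    (δ := 1 / 200) (by norm_num) (by norm_num) (hfam.trans (hexp.trans (by
      rw [← hs]; gcongr)))
  rw [← hs] at h1 h2 h3 h4
  have hout : ∀ v, (#{u | o v u = true} : ℝ) / m = s / 2 - 1 / (2 * m) := by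
    intro v
    have := ho.two_mul_card_out v
    rw [hs]; field_simp; linarith
  have hin : ∀ v, (#{u | o u v = true} : ℝ) / m = s / 2 - 1 / (2 * m) := by
    intro v
    have := ho.two_mul_card_in v
    rw [hs]; field_simp; linarith
  have hinv : 1 / (2 * (m : ℝ)) ≤ 1 / 200 * s := by
    have : 1 / (2 * (m : ℝ)) ≤ 1 := by
      rw [div_le_one (by positivity)]; linarith
    linarith
  have hinv0 : 0 ≤ 1 / (2 * (m : ℝ)) := by positivity
  simp only [hin] at h2
  simp only [hout] at h3
  obtain ⟨q, hq⟩ : ∃ q : ℕ, q = ⌈(101 / 200 : ℝ) * s⌉₊ := ⟨_, rfl⟩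
  have hq1 : (101 / 200 : ℝ) * s ≤ q := by rw [hq]; exact Nat.le_ceil _
  have hq2 : (q : ℝ) ≤ 102 / 200 * s := by
    have := (Nat.ceil_lt_add_one (a := (101 / 200 : ℝ) * s) (by positivity)).le
    rw [← hq] at this
    linarith
  have hq0 : (0 : ℝ) < q := by linarith
  have hmq : (m : ℝ) ≤ n / q := by
    rw [le_div_iff₀ hq0, hns]
    gcongr
    linarith
  obtain ⟨S, hS1, hS2, hS3⟩ := ho.exists_packing_of_labelling (q := q) (by exact_mod_cast hq0) ℓ
    (δ := 1 / 200) (by norm_num) (by norm_num)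
    (fun v i => by
      have := (abs_le.1 (h2 v i)).2
      have : (#{u | o u v = true ∧ ℓ u = i} : ℝ) ≤ q := by linarith
      exact_mod_cast this)
    (fun v i => by
      have := (abs_le.1 (h3 v i)).2
      have : (#{u | o v u = true ∧ ℓ u = i} : ℝ) ≤ q := by linarith
      exact_mod_cast this)
    (by
      refine le_trans ?_ (hfam.trans (hexp.trans (by gcongr)))
      have : (n : ℝ) ^ 2 * 1 ≤ (n + 1) ^ 2 * m := by gcongr <;> linarith
      linarith)
  refine ⟨S, hS1, hS2, ?_⟩
  have hcount := le_sum_sum_min o ℓ (C := 199 / 200 * s) (C' := 201 / 200 * s)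
    (L := 98 / 200 * s) (E := 2 * m * (1 / 200 * s) + 1) (F := 1 / 200 * (n / q)) (q := q)
    (by positivity) (by positivity) (by positivity) hq0
    (fun i => by linarith [(abs_le.1 (h1 i)).1])
    (fun i => by linarith [(abs_le.1 (h1 i)).2])
    (fun v i => by linarith [(abs_le.1 (h2 v i)).1])
    (fun v i => by linarith [(abs_le.1 (h3 v i)).1])
    (fun a b hab => ho.card_laterMidpoints_le ℓ (by positivity) h4 a b hab)
  have hfinal : 2 * (n : ℝ) ^ 2 / 13 ≤
      199 / 200 * s * (m * (m - 1) / 2) * (98 / 200 * s) ^ 2 / q -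
      m * (201 / 200 * s) ^ 2 * ((2 * m * (1 / 200 * s) + 1) / q + 1 / 200 * (n / q)) := by
    have e1 : 199 / 200 * s * (m * (m - 1) / 2) * (98 / 200 * s) ^ 2 / q -
      m * (201 / 200 * s) ^ 2 * ((2 * m * (1 / 200 * s) + 1) / q + 1 / 200 * (n / q)) =
      (m * s ^ 2 * (199 / 200 * s * ((m - 1) / 2) * (98 / 200) ^ 2 -
        (201 / 200) ^ 2 * (2 * m * (1 / 200 * s) + 1 + 1 / 200 * (m * s)))) / q := by
      rw [hns]; field_simp
    rw [e1, le_div_iff₀ hq0]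
    have hms : (1000 : ℝ) * s ≤ m * s := by gcongr
    calc 2 * (n : ℝ) ^ 2 / 13 * q ≤ 2 * (n : ℝ) ^ 2 / 13 * (102 / 200 * s) := by gcongr
      _ = m * s ^ 2 * (2 / 13 * (102 / 200) * (m * s)) := by rw [hns]; ring
      _ ≤ _ := by
        gcongr
        nlinarith
  linarith

/-- For every `ε > 0` there exists `N` such that for every odd integer `n ≥ N`, every regular
tournament on `n` vertices contains at least `(1/(8+√32))·n²·(1−ε)` pairwise arc-disjoint
directed 4-cycles. -/
theorem packing_C4_regular_tournament :
    ∀ ε : ℝ, 0 < ε → ∃ N : ℕ, ∀ n : ℕ, Odd n → N ≤ n →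
      ∀ o : Fin n → Fin n → Bool, IsRegularTournament o →
        ∃ S : Finset (Fin n × Fin n × Fin n × Fin n),
          (∀ q ∈ S, IsDirC4T o q) ∧
          (∀ q ∈ S, ∀ q' ∈ S, q ≠ q' → Disjoint (c4ArcsT q) (c4ArcsT q')) ∧
          (1 / (8 + Real.sqrt 32)) * n ^ 2 * (1 - ε) ≤ S.card := by
  intro ε hε
  have hlim : ∀ᶠ x : ℝ in Filter.atTop, 2 * (x + 1) ^ 5 ≤ Real.exp ((1 / 200) ^ 2 / 4 * x) := by
    have h := (isLittleO_pow_exp_pos_mul_atTop 5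
      (b := (1 / 200) ^ 2 / 4) (by norm_num)).bound (c := 1 / 64) (by norm_num)
    filter_upwards [h, Filter.eventually_ge_atTop 1] with x hx hx1
    rw [Real.norm_of_nonneg (by positivity), Real.norm_of_nonneg (by positivity)] at hx
    calc 2 * (x + 1) ^ 5 ≤ 2 * (x + x) ^ 5 := by gcongr
      _ = 64 * x ^ 5 := by ring
      _ ≤ _ := by linarith
  obtain ⟨M, hM⟩ := Filter.eventually_atTop.1 (tendsto_natCast_atTop_atTop.eventually hlim)
  refine ⟨max M 1000 * max M 1000, fun n _ hn o ho => ?_⟩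
  have hm : max M 1000 ≤ n.sqrt := Nat.le_sqrt.2 hn
  obtain ⟨S, h1, h2, h3⟩ := ho.exists_packing ((le_max_right _ _).trans hm) (Nat.sqrt_le n)
    (Nat.lt_succ_sqrt n) (hM _ ((le_max_left _ _).trans hm))
  refine ⟨S, h1, h2, le_trans ?_ h3⟩
  have hsqrt : (5 : ℝ) ≤ Real.sqrt 32 := Real.le_sqrt_of_sq_le (by norm_num)
  have hc : 1 / (8 + Real.sqrt 32) ≤ 1 / 13 := by
    apply one_div_le_one_div_of_le <;> linarith
  have hpos : 0 ≤ 1 / (8 + Real.sqrt 32) * (n : ℝ) ^ 2 := by positivity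
  calc 1 / (8 + Real.sqrt 32) * (n : ℝ) ^ 2 * (1 - ε)
      ≤ 1 / (8 + Real.sqrt 32) * (n : ℝ) ^ 2 * 1 := by gcongr; linarith
    _ ≤ 1 / 13 * (n : ℝ) ^ 2 * 1 := by gcongr
    _ = _ := by ring
end

section
/- For every ε > 0 there exists N such that for all even integers m, n with min{m,n} ≥ N the following holds. Let A and B be antipodal matrices in 𝒜(R,S), i.e., A + B is the all-one m×n matrix (so every row sum is n/2 and every column sum is m/2). Then the distance i(A,B) between A and B in the interchange graph G(R,S) satisfies mn/4 ≤ i(A,B) ≤ ((1+√2)/(4+√8))·mn·(1+ε). -/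
open Finset

/-- An `m × n` `{0,1}`-matrix (encoded with `Bool` entries) in which every row sum is `n/2`
and every column sum is `m/2`; this is membership in `𝒜(R,S)` for the relevant `R`, `S`. -/
def HalfRowColSums {m n : ℕ} (A : Fin m → Fin n → Bool) : Prop :=
  (∀ i : Fin m, 2 * (univ.filter fun j : Fin n => A i j = true).card = n) ∧
  (∀ j : Fin n, 2 * (univ.filter fun i : Fin m => A i j = true).card = m)

/-- `B` is obtained from `A` by a single interchange: on some pair of rows `i₁ ≠ i₂` and pair
of columns `j₁ ≠ j₂`, a `2 × 2` identity submatrix is replaced by the `2 × 2` permutation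
matrix (the "vice versa" direction is obtained by swapping the roles of the two rows),
and all other entries are unchanged. -/
def IsInterchange {m n : ℕ} (A B : Fin m → Fin n → Bool) : Prop :=
  ∃ i₁ i₂ : Fin m, ∃ j₁ j₂ : Fin n, i₁ ≠ i₂ ∧ j₁ ≠ j₂ ∧
    A i₁ j₁ = true ∧ A i₁ j₂ = false ∧ A i₂ j₁ = false ∧ A i₂ j₂ = true ∧
    B i₁ j₁ = false ∧ B i₁ j₂ = true ∧ B i₂ j₁ = true ∧ B i₂ j₂ = false ∧
    ∀ i : Fin m, ∀ j : Fin n, (i ≠ i₁ ∧ i ≠ i₂) ∨ (j ≠ j₁ ∧ j ≠ j₂) → A i j = B i j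

/-- There is a walk of length `k` from `A` to `B` in the interchange graph. The graph distance
`i(A,B)` is the least such `k`. -/
def InterchangeChain {m n : ℕ} (k : ℕ) (A B : Fin m → Fin n → Bool) : Prop :=
  ∃ f : ℕ → Fin m → Fin n → Bool, f 0 = A ∧ f k = B ∧
    ∀ i : ℕ, i < k → IsInterchange (f i) (f (i + 1))

/-- The number of entries in which two matrices differ. -/
def mismatch {m n : ℕ} (A B : Fin m → Fin n → Bool) : ℤ :=
  ∑ i, ∑ j, if A i j = B i j then 0 else 1

/-- The entry of `A - B` at `(i, j)`. -/
def entryDiff {m n : ℕ} (A B : Fin m → Fin n → Bool) (i : Fin m) (j : Fin n) : ℤ :=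
  (A i j).toInt - (B i j).toInt

/-- `A` and `B` have the same row sums and the same column sums. -/
def SameSums {m n : ℕ} (A B : Fin m → Fin n → Bool) : Prop :=
  (∀ i, ∑ j, entryDiff A B i j = 0) ∧ ∀ j, ∑ i, entryDiff A B i j = 0

/-- The matrix obtained from `A` by complementing the entries in rows `i₁, i₂` and
columns `j₁, j₂`. -/
def flipFour {m n : ℕ} (A : Fin m → Fin n → Bool) (i₁ i₂ : Fin m) (j₁ j₂ : Fin n) :
    Fin m → Fin n → Bool :=
  fun i j => if (i = i₁ ∨ i = i₂) ∧ (j = j₁ ∨ j = j₂) then !A i j else A i j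

section Interchange

variable {m n : ℕ} {A B C : Fin m → Fin n → Bool}

theorem IsInterchange.symm (h : IsInterchange A B) : IsInterchange B A := by
  obtain ⟨i₁, i₂, j₁, j₂, hi, hj, h1, h2, h3, h4, h5, h6, h7, h8, h9⟩ := h
  exact ⟨i₁, i₂, j₂, j₁, hi, hj.symm, h6, h5, h8, h7, h2, h1, h4, h3,
    fun i j h => (h9 i j (h.imp id And.symm)).symm⟩

theorem isInterchange_flipFour {i₁ i₂ : Fin m} {j₁ j₂ : Fin n} (hi : i₁ ≠ i₂) (hj : j₁ ≠ j₂)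
    (h₁ : A i₁ j₁ = true) (h₂ : A i₁ j₂ = false) (h₃ : A i₂ j₁ = false) (h₄ : A i₂ j₂ = true) :
    IsInterchange A (flipFour A i₁ i₂ j₁ j₂) := by
  refine ⟨i₁, i₂, j₁, j₂, hi, hj, h₁, h₂, h₃, h₄, ?_, ?_, ?_, ?_, ?_⟩
  · simp [flipFour, h₁]
  · simp [flipFour, h₂]
  · simp [flipFour, h₃]
  · simp [flipFour, h₄]
  · intro i j h
    have : ¬ ((i = i₁ ∨ i = i₂) ∧ (j = j₁ ∨ j = j₂)) := by tauto
    simp [flipFour, this]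

theorem SameSums.trans (h : SameSums A B) (h' : SameSums B C) : SameSums A C := by
  have key : ∀ i j, entryDiff A C i j = entryDiff A B i j + entryDiff B C i j := fun i j => by
    simp [entryDiff]
  constructor
  · intro i
    simp only [key, sum_add_distrib, h.1, h'.1, add_zero]
  · intro j
    simp only [key, sum_add_distrib, h.2, h'.2, add_zero]

theorem IsInterchange.sameSums (h : IsInterchange A B) : SameSums A B := by
  obtain ⟨i₁, i₂, j₁, j₂, hi, hj, h1, h2, h3, h4, h5, h6, h7, h8, h9⟩ := h
  have key : ∀ i j, entryDiff A B i j =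
      ((if i = i₁ then 1 else 0) - (if i = i₂ then 1 else 0)) *
        ((if j = j₁ then 1 else 0) - (if j = j₂ then 1 else 0)) := by
    intro i j
    by_cases h : (i ≠ i₁ ∧ i ≠ i₂) ∨ (j ≠ j₁ ∧ j ≠ j₂)
    · rcases h with ⟨ha, hb⟩ | ⟨ha, hb⟩ <;> simp [entryDiff, h9 i j (by tauto), ha, hb]
    · have h' : (i = i₁ ∨ i = i₂) ∧ (j = j₁ ∨ j = j₂) := by tauto
      rcases h' with ⟨rfl | rfl, rfl | rfl⟩ <;>
        simp [entryDiff, h1, h2, h3, h4, h5, h6, h7, h8, hi, hj, hi.symm, hj.symm]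
  constructor
  · intro i
    simp [key, ← mul_sum]
  · intro j
    simp [key, ← sum_mul]

theorem mismatch_nonneg (A B : Fin m → Fin n → Bool) : 0 ≤ mismatch A B :=
  sum_nonneg fun i _ => sum_nonneg fun j _ => by split_ifs <;> simp

theorem mismatch_comm (A B : Fin m → Fin n → Bool) : mismatch A B = mismatch B A := by
  simp only [mismatch, eq_comm]

theorem sum_sum_eq_four {f : Fin m → Fin n → ℤ} {i₁ i₂ : Fin m} {j₁ j₂ : Fin n} (hi : i₁ ≠ i₂)
    (hj : j₁ ≠ j₂) (hf : ∀ i j, (i ≠ i₁ ∧ i ≠ i₂) ∨ (j ≠ j₁ ∧ j ≠ j₂) → f i j = 0) :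
    ∑ i, ∑ j, f i j = f i₁ j₁ + f i₁ j₂ + (f i₂ j₁ + f i₂ j₂) := by
  have hrow : ∀ i, ∑ j, f i j = f i j₁ + f i j₂ := fun i => by
    rw [← sum_subset (subset_univ {j₁, j₂}), sum_pair hj]
    intro j _ h
    exact hf i j (Or.inr (by simpa using h))
  rw [← sum_subset (subset_univ {i₁, i₂}), sum_pair hi, hrow, hrow]
  intro i _ h
  exact sum_eq_zero fun j _ => hf i j (Or.inl (by simpa using h))

theorem mismatch_sub_mismatch {i₁ i₂ : Fin m} {j₁ j₂ : Fin n} (hi : i₁ ≠ i₂) (hj : j₁ ≠ j₂)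
    (h : ∀ i j, (i ≠ i₁ ∧ i ≠ i₂) ∨ (j ≠ j₁ ∧ j ≠ j₂) → A i j = B i j) :
    mismatch A C - mismatch B C =
      ((if A i₁ j₁ = C i₁ j₁ then 0 else 1) - (if B i₁ j₁ = C i₁ j₁ then 0 else 1)) +
      ((if A i₁ j₂ = C i₁ j₂ then 0 else 1) - (if B i₁ j₂ = C i₁ j₂ then 0 else 1)) +
      (((if A i₂ j₁ = C i₂ j₁ then 0 else 1) - (if B i₂ j₁ = C i₂ j₁ then 0 else 1)) +
      ((if A i₂ j₂ = C i₂ j₂ then 0 else 1) - (if B i₂ j₂ = C i₂ j₂ then 0 else 1))) := by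
  rw [← sum_sum_eq_four (f := fun i j =>
    ((if A i j = C i j then 0 else 1) - (if B i j = C i j then 0 else 1) : ℤ)) hi hj]
  · simp only [mismatch, sum_sub_distrib]
  · intro i j hij
    simp [h i j hij]

theorem IsInterchange.mismatch_le (h : IsInterchange A B) (C : Fin m → Fin n → Bool) :
    mismatch A C ≤ mismatch B C + 4 := by
  obtain ⟨i₁, i₂, j₁, j₂, hi, hj, -, -, -, -, -, -, -, -, h9⟩ := h
  have := mismatch_sub_mismatch (C := C) hi hj h9
  split_ifs at this <;> linarith

theorem InterchangeChain.refl (A : Fin m → Fin n → Bool) : InterchangeChain 0 A A :=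
  ⟨fun _ => A, rfl, rfl, by simp⟩

theorem InterchangeChain.cons {k : ℕ} (h : IsInterchange A B) (h' : InterchangeChain k B C) :
    InterchangeChain (k + 1) A C := by
  obtain ⟨f, h0, hk, hf⟩ := h'
  refine ⟨fun i => Nat.casesOn i A f, rfl, hk, ?_⟩
  rintro (_ | i) hi
  · simpa [h0] using h
  · exact hf i (by lia)

theorem InterchangeChain.snoc {k : ℕ} (h : InterchangeChain k A B) (h' : IsInterchange B C) :
    InterchangeChain (k + 1) A C := by
  obtain ⟨f, h0, hk, hf⟩ := h
  refine ⟨fun i => if i ≤ k then f i else C, by simpa, by simp, ?_⟩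
  intro i hi
  rcases Nat.lt_or_ge i k with h1 | h1
  · simpa [h1.le, Nat.succ_le_of_lt h1] using hf i h1
  · obtain rfl : i = k := by lia
    simpa [hk] using h'

theorem InterchangeChain.mismatch_le {k : ℕ} (h : InterchangeChain k A B) :
    mismatch A B ≤ 4 * k := by
  obtain ⟨f, rfl, rfl, hf⟩ := h
  have : ∀ i ≤ k, mismatch (f (k - i)) (f k) ≤ 4 * i := by
    intro i
    induction i with
    | zero => simp [mismatch]
    | succ i ih =>
      intro hi
      have h1 := (hf (k - (i + 1)) (by lia)).mismatch_le (f k)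
      rw [show k - (i + 1) + 1 = k - i by lia] at h1
      have := ih (by lia)
      push_cast
      linarith
  simpa using this k le_rfl

/-- Two distinct matrices with the same row and column sums can be brought closer to each other
by an interchange in one of them. -/
theorem exists_isInterchange_mismatch_le (h : SameSums A B) (hne : A ≠ B) :
    (∃ A', IsInterchange A A' ∧ mismatch A' B + 2 ≤ mismatch A B) ∨
      ∃ B', IsInterchange B B' ∧ mismatch A B' + 2 ≤ mismatch A B := by
  by_contra hcon
  rw [not_or] at hcon
  obtain ⟨hA, hB⟩ := hcon
  push Not at hA hB
  -- a configuration `+ - +` on three corners of a rectangle forces a fourth `+`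
  have key : ∀ i₁ i₂ j₁ j₂, A i₁ j₁ = true → B i₁ j₁ = false → A i₂ j₁ = false → B i₂ j₁ = true →
      A i₂ j₂ = true → B i₂ j₂ = false → A i₁ j₂ = true ∧ B i₁ j₂ = false := by
    intro i₁ i₂ j₁ j₂ h1 h2 h3 h4 h5 h6
    have hi : i₁ ≠ i₂ := by rintro rfl; simp [h1] at h3
    have hj : j₁ ≠ j₂ := by rintro rfl; simp [h3] at h5
    have hflip : ∀ (X : Fin m → Fin n → Bool) i j,
        (i ≠ i₁ ∧ i ≠ i₂) ∨ (j ≠ j₁ ∧ j ≠ j₂) → X i j = flipFour X i₁ i₂ j₁ j₂ i j := by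
      intro X i j h
      have : ¬ ((i = i₁ ∨ i = i₂) ∧ (j = j₁ ∨ j = j₂)) := by tauto
      simp [flipFour, this]
    constructor
    · by_contra h7
      rw [Bool.not_eq_true] at h7
      have := hA _ (isInterchange_flipFour hi hj h1 h7 h3 h5)
      have h8 := mismatch_sub_mismatch (C := B) hi hj (hflip A)
      simp only [flipFour, h1, h2, h3, h4, h5, h6, h7] at h8
      cases h9 : B i₁ j₂ <;> simp [h9] at h8 <;> linarith
    · by_contra h7
      rw [Bool.not_eq_false] at h7
      have h' := isInterchange_flipFour hi.symm hj h4 h6 h2 h7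
      have := hB _ h'
      rw [mismatch_comm A, mismatch_comm A] at this
      have h8 := mismatch_sub_mismatch (A := B) (B := flipFour B i₂ i₁ j₁ j₂) (C := A) hi hj
        (fun i j h => by rw [hflip B i j h]; simp only [flipFour, or_comm])
      simp only [flipFour, h1, h2, h3, h4, h5, h6, h7] at h8
      cases h9 : A i₁ j₂ <;> simp [h9] at h8 <;> linarith
  obtain ⟨i₀, j₀, h1, h2⟩ : ∃ i j, A i j = true ∧ B i j = false := by
    by_contra hno
    push Not at hno
    apply hne
    funext i j
    have hle : ∀ j, entryDiff A B i j ≤ 0 := fun j => by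
      have := hno i j
      cases ha : A i j <;> cases hb : B i j <;> simp_all [entryDiff]
    have h0 := (sum_eq_zero_iff_of_nonpos fun j _ => hle j).1 (h.1 i) j (mem_univ j)
    cases ha : A i j <;> cases hb : B i j <;> simp_all [entryDiff]
  let P : Finset (Fin n) := univ.filter fun j => A i₀ j = true ∧ B i₀ j = false
  let R : Finset (Fin m) := univ.filter fun i => ∃ j ∈ P, A i j = false ∧ B i j = true
  have hrow : 0 ≤ ∑ i ∈ R, ∑ j ∈ P, entryDiff A B i j := by
    refine sum_nonneg fun i hi => ?_
    obtain ⟨j, hj, h3, h4⟩ := (mem_filter.1 hi).2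
    obtain ⟨h5, h6⟩ := (mem_filter.1 hj).2
    rw [← h.1 i, ← sum_add_sum_compl P]
    refine add_le_of_nonpos_right (sum_nonpos fun j' hj' => ?_)
    have : ¬ (A i j' = true ∧ B i j' = false) := fun h' =>
      (mem_compl.1 hj') (by simpa [P] using key i₀ i j j' h5 h6 h3 h4 h'.1 h'.2)
    cases ha : A i j' <;> cases hb : B i j' <;> simp_all [entryDiff]
  have hcol : ∑ j ∈ P, ∑ i ∈ R, entryDiff A B i j < 0 := by
    refine sum_neg (fun j hj => ?_) ⟨j₀, by simp [P, h1, h2]⟩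
    rw [← h.2 j, ← sum_add_sum_compl R]
    refine lt_add_of_pos_right _ (sum_pos' (fun i hi => ?_) ⟨i₀, ?_, ?_⟩)
    · have : ¬ (A i j = false ∧ B i j = true) := fun h' =>
        (mem_compl.1 hi) (by simp only [R, mem_filter, mem_univ, true_and]; exact ⟨j, hj, h'⟩)
      cases ha : A i j <;> cases hb : B i j <;> simp_all [entryDiff]
    · simp only [R, mem_compl, mem_filter, mem_univ, true_and, not_exists, not_and]
      intro j' hj' h3
      simp [(mem_filter.1 hj').2.1] at h3
    · obtain ⟨h5, h6⟩ := (mem_filter.1 hj).2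
      simp [entryDiff, h5, h6]
  rw [sum_comm] at hcol
  exact absurd hrow (not_le.2 hcol)

theorem exists_interchangeChain (h : SameSums A B) :
    ∃ k : ℕ, InterchangeChain k A B ∧ 2 * (k : ℤ) ≤ mismatch A B := by
  obtain ⟨d, hd⟩ : ∃ d : ℕ, mismatch A B ≤ d := ⟨_, Int.self_le_toNat _⟩
  induction d using Nat.strong_induction_on generalizing A B with
  | _ d ih =>
    by_cases hAB : A = B
    · subst hAB
      exact ⟨0, .refl A, by simpa using mismatch_nonneg A A⟩
    · rcases exists_isInterchange_mismatch_le h hAB with ⟨A', hA', hle⟩ | ⟨B', hB', hle⟩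
      · have := mismatch_nonneg A' B
        obtain ⟨k, hk, hk'⟩ := ih (d - 2) (by lia) (hA'.symm.sameSums.trans h) (by lia)
        exact ⟨k + 1, hk.cons hA', by push_cast; linarith⟩
      · have := mismatch_nonneg A B'
        obtain ⟨k, hk, hk'⟩ := ih (d - 2) (by lia) (h.trans hB'.sameSums) (by lia)
        exact ⟨k + 1, hk.snoc hB'.symm, by push_cast; linarith⟩

end Interchange

section Packing

variable {m n : ℕ} {A B : Fin m → Fin n → Bool}

/-- If `U i i'` is a set of columns in which `A - B` is `1` in row `i` and `-1` in row `i'`, and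
in each column these pairs of rows are disjoint, then each pair of a column in `U i i'` and a column
in `U i' i` saves one interchange with respect to the trivial bound. -/
theorem exists_interchangeChain_of_packing (h : SameSums A B) (U : Fin m → Fin m → Finset (Fin n))
    (hU : ∀ i i', ∀ j ∈ U i i', A i j = true ∧ B i j = false ∧ A i' j = false ∧ B i' j = true)
    (hleft : ∀ i i₁ i₂ j, j ∈ U i i₁ → j ∈ U i i₂ → i₁ = i₂)
    (hright : ∀ i i₁ i₂ j, j ∈ U i₁ i → j ∈ U i₂ i → i₁ = i₂) :
    ∃ k : ℕ, InterchangeChain k A B ∧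
      2 * (k : ℤ) + ((∑ i, ∑ i', min (#(U i i')) (#(U i' i)) : ℕ) : ℤ) ≤ mismatch A B := by
  obtain ⟨d, hd⟩ : ∃ d : ℕ, ∑ i, ∑ i', #(U i i') = d := ⟨_, rfl⟩
  induction d using Nat.strong_induction_on generalizing A U with
  | _ d ih =>
  by_cases h0 : ∀ i i', min (#(U i i')) (#(U i' i)) = 0
  · simpa [h0] using exists_interchangeChain h
  push Not at h0
  obtain ⟨i₁, i₂, hmin⟩ := h0
  obtain ⟨j₁, hj₁⟩ : (U i₁ i₂).Nonempty := by
    rw [nonempty_iff_ne_empty]; intro h; simp [h] at hmin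
  obtain ⟨j₂, hj₂⟩ : (U i₂ i₁).Nonempty := by
    rw [nonempty_iff_ne_empty]; intro h; simp [h] at hmin
  obtain ⟨a1, b1, a2, b2⟩ := hU _ _ _ hj₁
  obtain ⟨a3, b3, a4, b4⟩ := hU _ _ _ hj₂
  have hi : i₁ ≠ i₂ := by rintro rfl; simp [a1] at a2
  have hj : j₁ ≠ j₂ := by rintro rfl; simp [a1] at a4
  have hint := isInterchange_flipFour hi hj a1 a4 a2 a3
  have hflip : ∀ i j, (i ≠ i₁ ∧ i ≠ i₂) ∨ (j ≠ j₁ ∧ j ≠ j₂) →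
      A i j = flipFour A i₁ i₂ j₁ j₂ i j := by
    intro i j h
    have : ¬ ((i = i₁ ∨ i = i₂) ∧ (j = j₁ ∨ j = j₂)) := by tauto
    simp [flipFour, this]
  have hmis := mismatch_sub_mismatch (C := B) hi hj hflip
  simp only [flipFour, a1, a2, a3, a4, b1, b2, b3, b4] at hmis
  simp only [true_or, or_true, and_self, if_true, Bool.not_true, Bool.not_false,
    Bool.true_eq_false, Bool.false_eq_true, if_false] at hmis
  let U' : Fin m → Fin m → Finset (Fin n) := fun i i' =>
    if i = i₁ ∧ i' = i₂ then (U i i').erase j₁ else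
    if i = i₂ ∧ i' = i₁ then (U i i').erase j₂ else U i i'
  have hsub : ∀ i i', U' i i' ⊆ U i i' := by
    intro i i'
    simp only [U']
    split_ifs
    · exact erase_subset _ _
    · exact erase_subset _ _
    · exact Subset.rfl
  have h12 : #(U' i₁ i₂) + 1 = #(U i₁ i₂) := by
    simp [U', card_erase_add_one hj₁]
  have h21 : #(U' i₂ i₁) + 1 = #(U i₂ i₁) := by
    simp [U', hi.symm, card_erase_add_one hj₂]
  have hother : ∀ i i', (i ≠ i₁ ∧ i ≠ i₂) ∨ (i' ≠ i₁ ∧ i' ≠ i₂) → U' i i' = U i i' := by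
    intro i i' h
    simp only [U']
    rw [if_neg (by tauto), if_neg (by tauto)]
  have hdiag : ∀ i, U i i = ∅ := by
    intro i
    refine eq_empty_of_forall_notMem fun j hj => ?_
    have := hU _ _ _ hj
    simp [this.1] at this
  have hdiag' : ∀ i, U' i i = ∅ := fun i => subset_empty.1 (hdiag i ▸ hsub i i)
  have hsum : ∑ i, ∑ i', min (#(U i i')) (#(U i' i)) =
      ∑ i, ∑ i', min (#(U' i i')) (#(U' i' i)) + 2 := by
    have := sum_sum_eq_four (f := fun i i' =>
      ((min (#(U i i')) (#(U i' i)) : ℕ) : ℤ) - (min (#(U' i i')) (#(U' i' i)) : ℕ)) hi hi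
      (fun i i' h => by rw [hother i i' h, hother i' i h.symm, sub_self])
    simp only [sum_sub_distrib, hdiag, hdiag', card_empty, min_self, sub_self] at this
    rw [← h12, ← h21, min_add_add_right, min_add_add_right] at this
    push_cast at this
    zify
    linarith
  have hlt : ∑ i, ∑ i', #(U' i i') < d := by
    rw [← hd]
    refine sum_lt_sum (fun i _ => sum_le_sum fun i' _ => card_le_card (hsub i i'))
      ⟨i₁, mem_univ _, sum_lt_sum (fun i' _ => card_le_card (hsub i₁ i')) ⟨i₂, mem_univ _, ?_⟩⟩
    lia
  obtain ⟨k, hk, hk'⟩ := ih _ hlt (hint.symm.sameSums.trans h) U' (fun i i' j hj' => by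
      have hju := hsub _ _ hj'
      have := hU _ _ _ hju
      have e : ∀ r, r = i ∨ r = i' → flipFour A i₁ i₂ j₁ j₂ r j = A r j := by
        intro r hr
        refine (hflip r j ?_).symm
        by_contra hcon
        have l1 := hleft i i' i₁ j
        have l2 := hleft i i' i₂ j
        have r1 := hright i' i i₁ j
        have r2 := hright i' i i₂ j
        grind
      rw [e i (Or.inl rfl), e i' (Or.inr rfl)]
      exact this)
    (fun i k₁ k₂ j h₁ h₂ => hleft i k₁ k₂ j (hsub _ _ h₁) (hsub _ _ h₂))
    (fun i k₁ k₂ j h₁ h₂ => hright i k₁ k₂ j (hsub _ _ h₁) (hsub _ _ h₂)) rfl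
  refine ⟨k + 1, hk.cons hint, ?_⟩
  rw [hsum]
  push_cast at hk' ⊢
  linarith

end Packing

section Blocks

theorem sum_perm_mul_nonpos {α : Type*} [Fintype α] [DecidableEq α] {w : α → ℤ}
    (hw : ∑ i, w i = 0) {a b : α} (hab : a ≠ b) :
    ∑ σ : Equiv.Perm α, w (σ a) * w (σ b) ≤ 0 := by
  have hsymm : ∀ c ∈ univ.erase a, ∑ σ : Equiv.Perm α, w (σ a) * w (σ c) =
      ∑ σ : Equiv.Perm α, w (σ a) * w (σ b) := by
    intro c hc
    refine Fintype.sum_equiv (Equiv.mulRight (Equiv.swap b c)) _ _ fun σ => ?_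
    simp [Equiv.swap_apply_of_ne_of_ne hab (ne_of_mem_erase hc).symm]
  have htotal : ∑ c ∈ univ.erase a, ∑ σ : Equiv.Perm α, w (σ a) * w (σ c) ≤ 0 := by
    rw [sum_comm]
    refine sum_nonpos fun σ _ => ?_
    have : ∑ c ∈ univ.erase a, w (σ c) = -w (σ a) := by
      rw [eq_neg_iff_add_eq_zero, sum_erase_add _ _ (mem_univ a), Equiv.sum_comp σ w, hw]
    rw [← mul_sum, this]
    nlinarith [sq_nonneg (w (σ a))]
  rw [sum_congr rfl hsymm, sum_const, nsmul_eq_mul] at htotal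
  by_contra hpos
  have hcard : 0 < #(univ.erase a) := card_pos.2 ⟨b, by simp [hab.symm]⟩
  have : (0 : ℤ) < #(univ.erase a) := by exact_mod_cast hcard
  nlinarith

/-- If the rows of a `±1`-matrix add up to zero, then any prescribed number of disjoint blocks of
`s` rows can be chosen such that the block column sums are small in mean square. -/
theorem exists_embedding_sum_sq_le {m n β s : ℕ} (hβ : β * s ≤ m) (v : Fin m → Fin n → ℤ)
    (hv : ∀ i j, v i j ^ 2 = 1) (hcol : ∀ j, ∑ i, v i j = 0) :
    ∃ f : Fin β × Fin s ↪ Fin m,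
      ∑ b, ∑ j, (∑ x, v (f (b, x)) j) ^ 2 ≤ (β * s * n : ℕ) := by
  let e : Fin β × Fin s ↪ Fin m := finProdFinEquiv.toEmbedding.trans (Fin.castLEEmb hβ)
  have hterm : ∀ b j, ∑ σ : Equiv.Perm (Fin m), (∑ x, v (σ (e (b, x))) j) ^ 2 ≤
      ∑ _σ : Equiv.Perm (Fin m), (s : ℤ) := by
    intro b j
    simp only [sq, sum_mul_sum]
    rw [sum_comm]
    calc ∑ x, ∑ σ : Equiv.Perm (Fin m), ∑ y, v (σ (e (b, x))) j * v (σ (e (b, y))) j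
        ≤ ∑ x : Fin s, ∑ _σ : Equiv.Perm (Fin m), (1 : ℤ) := by
          refine sum_le_sum fun x _ => ?_
          rw [sum_comm, ← add_sum_erase _ _ (mem_univ x)]
          refine (add_le_of_nonpos_right (sum_nonpos fun y hy => ?_)).trans
            (sum_le_sum fun σ _ => ?_)
          · refine sum_perm_mul_nonpos (hcol j) fun hxy => ne_of_mem_erase hy ?_
            simpa using hxy.symm
          · rw [← sq, hv]
      _ = ∑ _σ : Equiv.Perm (Fin m), (s : ℤ) := by
          rw [sum_comm]; simp
  have htotal : ∑ σ : Equiv.Perm (Fin m), ∑ b, ∑ j, (∑ x, v (σ (e (b, x))) j) ^ 2 ≤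
      ∑ _σ : Equiv.Perm (Fin m), ((β * s * n : ℕ) : ℤ) := by
    rw [sum_comm]
    have : ∀ b, ∑ σ : Equiv.Perm (Fin m), ∑ j, (∑ x, v (σ (e (b, x))) j) ^ 2 ≤
        ∑ _j : Fin n, ∑ _σ : Equiv.Perm (Fin m), (s : ℤ) := fun b => by
      rw [sum_comm]
      exact sum_le_sum fun j _ => hterm b j
    refine (sum_le_sum fun b _ => this b).trans (le_of_eq ?_)
    simp
    ring
  obtain ⟨σ, -, hσ⟩ := exists_le_of_sum_le univ_nonempty htotal
  exact ⟨e.trans σ.toEmbedding, hσ⟩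

/-- The fibres of any function can be coloured with `K` colours in a balanced way. -/
theorem exists_balanced_coloring {J T : Type*} [Fintype J] [DecidableEq T] (P : J → T)
    (K : ℕ) [NeZero K] :
    ∃ c : J → ZMod K, ∀ t γ,
      #{j | P j = t} ≤ K * (#{j | P j = t ∧ c j = γ} + 1) := by
  classical
  let e : ∀ t, {j // P j = t} ≃ Fin (Fintype.card {j // P j = t}) := fun t => Fintype.equivFin _
  refine ⟨fun j => ((e (P j) ⟨j, rfl⟩ : ℕ) : ZMod K), fun t γ => ?_⟩
  have hK : 0 < K := NeZero.pos K
  have hcard : #{j | P j = t} = Fintype.card {j // P j = t} := (Fintype.card_subtype _).symm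
  set N := Fintype.card {j // P j = t} with hN
  have hle : #((range N).filter fun i => ((i : ℕ) : ZMod K) = γ) ≤
      #{j | P j = t ∧ ((e (P j) ⟨j, rfl⟩ : ℕ) : ZMod K) = γ} := by
    refine card_le_card_of_surjOn (fun j => if h : P j = t then (e t ⟨j, h⟩ : ℕ) else 0) ?_
    intro i hi
    simp only [coe_filter, mem_range, Set.mem_ofPred_eq] at hi
    refine ⟨((e t).symm ⟨i, hi.1⟩ : {j // P j = t}), ?_, ?_⟩
    · have hp := ((e t).symm ⟨i, hi.1⟩).2
      simp only [coe_filter, mem_univ, true_and, Set.mem_ofPred_eq, hp]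
      have : ∀ t' (j : J) (h : P j = t') (h' : t' = t),
          ((e t' ⟨j, h⟩ : ℕ)) = e t ⟨j, h.trans h'⟩ := by
        rintro t' j h rfl; rfl
      rw [this _ _ rfl hp]
      simpa using hi.2
    · have hp := ((e t).symm ⟨i, hi.1⟩).2
      simp [hp]
  have hcount : N ≤ K * (#((range N).filter fun i => ((i : ℕ) : ZMod K) = γ) + 1) := by
    have h1 : (range (N / K)).image (fun q => γ.val + K * q) ⊆
        (range N).filter fun i => ((i : ℕ) : ZMod K) = γ := by
      intro i hi
      obtain ⟨q, hq, rfl⟩ := mem_image.1 hi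
      have hγ := ZMod.val_lt γ
      have hq' : q + 1 ≤ N / K := mem_range.1 hq
      have : K * (q + 1) ≤ N := (Nat.mul_le_mul_left K hq').trans (Nat.mul_div_le N K)
      simp only [mem_filter, mem_range]
      exact ⟨by lia, by simp⟩
    have h2 := card_le_card h1
    rw [card_image_of_injective _ (fun a b hab => by
      have : K * a = K * b := by simpa using hab
      exact Nat.eq_of_mul_eq_mul_left hK this), card_range] at h2
    have := Nat.lt_mul_div_succ N hK
    exact this.le.trans (Nat.mul_le_mul_left K (by lia))
  rw [hcard]
  exact hcount.trans (Nat.mul_le_mul_left K (by lia))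

end Blocks

section BlockPacking

theorem exists_injOn_fibers {α β : Type*} [Fintype α] [DecidableEq β] (π : α → β) (K : ℕ)
    [NeZero K] (hK : ∀ b, #{x | π x = b} ≤ K) :
    ∃ u : α → ZMod K, ∀ x y, π x = π y → u x = u y → x = y := by
  have hemb : ∀ b, Nonempty ({x // π x = b} ↪ ZMod K) := fun b => by
    refine Function.Embedding.nonempty_of_card_le ?_
    rw [ZMod.card, Fintype.card_subtype]
    exact hK b
  let e := fun b => (hemb b).some
  refine ⟨fun x => e (π x) ⟨x, rfl⟩, fun x y hxy hu => ?_⟩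
  have : ∀ b (h : π y = b), e b ⟨y, h⟩ = e (π y) ⟨y, rfl⟩ := by rintro b rfl; rfl
  have h := (e (π x)).injective (hu.trans (this _ hxy.symm).symm)
  simpa using h

/-- In `s` rows with a fixed number of columns, each column can be given a matching between its
`true` and its `false` entries so that every pair of rows is matched about `1 / K` of the time
among those columns that have at most `K` entries of each kind. -/
theorem exists_column_matchings {s n : ℕ} (M : Fin s → Fin n → Bool) (K : ℕ) [NeZero K] :
    ∃ V : Fin s → Fin s → Finset (Fin n),
      (∀ x y, ∀ j ∈ V x y, M x j = true ∧ M y j = false) ∧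
      (∀ x y₁ y₂ j, j ∈ V x y₁ → j ∈ V x y₂ → y₁ = y₂) ∧
      (∀ y x₁ x₂ j, j ∈ V x₁ y → j ∈ V x₂ y → x₁ = x₂) ∧
      ∀ x y, #{j | M x j = true ∧ M y j = false ∧ ∀ b, #{z | M z j = b} ≤ K} ≤
        K * (#(V x y) + 2 ^ s) := by
  have hu : ∀ π : Fin s → Bool, ∃ u : Fin s → ZMod K, (∀ b, #{x | π x = b} ≤ K) →
      ∀ x y, π x = π y → u x = u y → x = y := fun π => by
    by_cases h : ∀ b, #{x | π x = b} ≤ K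
    · obtain ⟨u, hu⟩ := exists_injOn_fibers π K h
      exact ⟨u, fun _ => hu⟩
    · exact ⟨0, fun h' => absurd h' h⟩
  choose u hu using hu
  let π : Fin n → Fin s → Bool := fun j x => M x j
  obtain ⟨c, hc⟩ := exists_balanced_coloring π K
  refine ⟨fun x y => {j | (M x j = true ∧ M y j = false ∧ ∀ b, #{z | M z j = b} ≤ K) ∧
    c j = u (π j) x + u (π j) y}, ?_, ?_, ?_, ?_⟩
  · intro x y j hj
    obtain ⟨⟨h1, h2, -⟩, -⟩ := (mem_filter.1 hj).2
    exact ⟨h1, h2⟩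
  · intro x y₁ y₂ j h₁ h₂
    obtain ⟨⟨-, a1, a2⟩, a3⟩ := (mem_filter.1 h₁).2
    obtain ⟨⟨-, b1, -⟩, b3⟩ := (mem_filter.1 h₂).2
    exact hu (π j) a2 _ _ (a1.trans b1.symm) (add_left_cancel (a3.symm.trans b3))
  · intro y x₁ x₂ j h₁ h₂
    obtain ⟨⟨a1, -, a2⟩, a3⟩ := (mem_filter.1 h₁).2
    obtain ⟨⟨b1, -, -⟩, b3⟩ := (mem_filter.1 h₂).2
    exact hu (π j) a2 _ _ (a1.trans b1.symm) (add_right_cancel (a3.symm.trans b3))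
  · intro x y
    set G : Finset (Fin n) := {j | M x j = true ∧ M y j = false ∧ ∀ b, #{z | M z j = b} ≤ K}
      with hG
    set W : Finset (Fin n) := {j | (M x j = true ∧ M y j = false ∧ ∀ b, #{z | M z j = b} ≤ K) ∧
      c j = u (π j) x + u (π j) y} with hW
    have hfib : ∀ ρ : Fin s → Bool, #{j ∈ G | π j = ρ} ≤ K * (#{j ∈ W | π j = ρ} + 1) := by
      intro ρ
      by_cases hρ : ρ x = true ∧ ρ y = false ∧ ∀ b, #{z | ρ z = b} ≤ K
      · refine ((card_le_card ?_).trans (hc ρ (u ρ x + u ρ y))).trans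
          (Nat.mul_le_mul_left K (Nat.add_le_add_right (card_le_card ?_) 1))
        · intro j hj
          simp only [mem_filter, mem_univ, true_and] at hj ⊢
          exact hj.2
        · intro j hj
          simp only [mem_filter, mem_univ, true_and] at hj
          obtain ⟨rfl, hcj⟩ := hj
          simp only [hW, mem_filter, mem_univ, true_and, and_true]
          exact ⟨hρ, hcj⟩
      · rw [filter_eq_empty_iff.2, card_empty]
        · exact Nat.zero_le _
        · rintro j hj rfl
          exact hρ (by simpa [hG] using hj)
    calc #G = ∑ ρ : Fin s → Bool, #{j ∈ G | π j = ρ} :=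
          card_eq_sum_card_fiberwise fun j _ => mem_coe.2 (mem_univ _)
      _ ≤ ∑ ρ : Fin s → Bool, K * (#{j ∈ W | π j = ρ} + 1) := sum_le_sum fun ρ _ => hfib ρ
      _ = K * (#W + 2 ^ s) := by
          rw [← mul_sum, sum_add_distrib,
            ← card_eq_sum_card_fiberwise fun j _ => mem_coe.2 (mem_univ _)]
          simp

theorem exists_block_packing {t n : ℕ} (ht : 0 < t) (M : Fin (4 * t) → Fin n → Bool)
    (hM : ∀ x, 2 * #{j | M x j = true} = n) :
    ∃ V : Fin (4 * t) → Fin (4 * t) → Finset (Fin n),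
      (∀ x y, ∀ j ∈ V x y, M x j = true ∧ M y j = false) ∧
      (∀ x y₁ y₂ j, j ∈ V x y₁ → j ∈ V x y₂ → y₁ = y₂) ∧
      (∀ y x₁ x₂ j, j ∈ V x₁ y → j ∈ V x₂ y → x₁ = x₂) ∧
      4 * (n : ℤ) * t ^ 2 ≤
        3 * t * ((∑ x, ∑ y, min (#(V x y)) (#(V y x)) : ℕ) : ℤ) + 48 * t ^ 3 * 2 ^ (4 * t) +
          2 * ∑ j, (∑ x, if M x j = true then 1 else -1 : ℤ) ^ 2 := by
  have : NeZero (3 * t) := ⟨by lia⟩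
  obtain ⟨V, h1, h2, h3, h4⟩ := exists_column_matchings M (3 * t)
  refine ⟨V, h1, h2, h3, ?_⟩
  let α : Fin (4 * t) → Fin n → ℤ := fun x j => if M x j = true then 1 else 0
  let δ : Fin n → ℤ := fun j => if ∀ b, #{z | M z j = b} ≤ 3 * t then 0 else 1
  let a : Fin (4 * t) → Fin (4 * t) → ℤ := fun x y => ∑ j, α x j * (1 - α y j)
  let d : Fin (4 * t) → Fin (4 * t) → ℤ := fun x y => ∑ j, δ j * (α x j * (1 - α y j))
  have hα : ∀ x j, 0 ≤ α x j ∧ α x j ≤ 1 := fun x j => by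
    simp only [α]; split_ifs <;> simp
  have hδ : ∀ j, 0 ≤ δ j := fun j => by simp only [δ]; split_ifs <;> simp
  have hd : ∀ x y, 0 ≤ d x y := fun x y => sum_nonneg fun j _ =>
    mul_nonneg (hδ j) (mul_nonneg (hα x j).1 (sub_nonneg.2 (hα y j).2))
  have hG : ∀ x y, ((#{j | M x j = true ∧ M y j = false ∧ ∀ b, #{z | M z j = b} ≤ 3 * t} : ℕ) : ℤ) =
      a x y - d x y := by
    intro x y
    rw [card_filter, Nat.cast_sum, ← sum_sub_distrib]
    refine sum_congr rfl fun j _ => ?_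
    simp only [α, δ]
    by_cases hg : ∀ b, #{z | M z j = b} ≤ 3 * t <;> cases hx : M x j <;> cases hy : M y j <;>
      simp [hg, -Bool.forall_bool]
  have hrow : ∀ x, 2 * ∑ j, α x j = n := by
    intro x
    have := hM x
    rw [card_filter] at this
    simp only [α]
    exact_mod_cast this
  have hsymm : ∀ x y, a x y = a y x := by
    intro x y
    have hx := hrow x
    have hy := hrow y
    have hxy : ∑ j, α x j * α y j = ∑ j, α y j * α x j := sum_congr rfl fun j _ => mul_comm _ _
    simp only [a, mul_sub, mul_one, sum_sub_distrib]
    linarith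
  have hmin : ∀ x y, a x y - d x y - d y x ≤
      3 * t * ((min (#(V x y)) (#(V y x)) : ℕ) : ℤ) + 3 * t * 2 ^ (4 * t) := by
    intro x y
    have e1 : a x y - d x y ≤ 3 * t * (#(V x y) + 2 ^ (4 * t)) := by
      rw [← hG]; exact_mod_cast h4 x y
    have e2 : a y x - d y x ≤ 3 * t * (#(V y x) + 2 ^ (4 * t)) := by
      rw [← hG]; exact_mod_cast h4 y x
    have := hsymm x y
    have := hd x y
    have := hd y x
    rcases min_choice (#(V x y)) (#(V y x)) with h | h <;> rw [h] <;> linarith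
  have hcol : ∀ j, 16 * (t : ℤ) ^ 2 - 8 * (∑ x, if M x j = true then 1 else -1 : ℤ) ^ 2 ≤
      4 * ((1 - 2 * δ j) * ((∑ x, α x j) * ∑ y, (1 - α y j))) := by
    intro j
    have hP : ((#{z | M z j = true} : ℕ) : ℤ) = ∑ x, α x j := by
      rw [card_filter, Nat.cast_sum]
      exact sum_congr rfl fun x _ => by simp [α]
    have hQ : ((#{z | M z j = false} : ℕ) : ℤ) = ∑ x, (1 - α x j) := by
      rw [card_filter, Nat.cast_sum]
      exact sum_congr rfl fun x _ => by cases h : M x j <;> simp [α, h]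
    have hS : (∑ x, if M x j = true then 1 else -1 : ℤ) = ∑ x, α x j - ∑ x, (1 - α x j) := by
      rw [← sum_sub_distrib]
      exact sum_congr rfl fun x _ => by cases h : M x j <;> simp [α, h]
    have hPQ : ∑ x, α x j + ∑ x, (1 - α x j) = 4 * t := by
      rw [← sum_add_distrib]; simp
    rw [hS]
    by_cases hg : ∀ b, #{z | M z j = b} ≤ 3 * t
    · have : δ j = 0 := if_pos hg
      rw [this]
      generalize ∑ x, α x j = p at *
      generalize ∑ x, (1 - α x j) = q at *
      have : (p + q) ^ 2 = (4 * t) ^ 2 := by rw [hPQ]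
      nlinarith [sq_nonneg (p - q)]
    · have : δ j = 1 := if_neg hg
      rw [this]
      have hbig : 3 * (t : ℤ) < ∑ x, α x j ∨ 3 * (t : ℤ) < ∑ x, (1 - α x j) := by
        rw [← hP, ← hQ]
        push Not at hg
        obtain ⟨b, hb⟩ := hg
        cases b
        · exact Or.inr (by exact_mod_cast hb)
        · exact Or.inl (by exact_mod_cast hb)
      generalize ∑ x, α x j = p at *
      generalize ∑ x, (1 - α x j) = q at *
      have hsq : (p + q) ^ 2 = (4 * t) ^ 2 := by rw [hPQ]
      have : (2 * (t : ℤ)) ^ 2 ≤ (p - q) ^ 2 := by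
        rcases hbig with h | h
        · exact pow_le_pow_left₀ (by positivity) (by linarith) 2
        · rw [← neg_sq (p - q)]
          exact pow_le_pow_left₀ (by positivity) (by linarith) 2
      nlinarith
  have hswap : ∑ x, ∑ y, (a x y - d x y - d y x) =
      ∑ j, (1 - 2 * δ j) * ((∑ x, α x j) * ∑ y, (1 - α y j)) := by
    have hdd : ∑ x, ∑ y, d y x = ∑ x, ∑ y, d x y := sum_comm
    have hsub : ∑ x, ∑ y, (a x y - d x y - d y x) =
        ∑ x, ∑ y, a x y - ∑ x, ∑ y, d x y - ∑ x, ∑ y, d y x := by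
      simp only [sum_sub_distrib]
    rw [hsub, hdd]
    have ha' : ∑ x, ∑ y, a x y = ∑ j, (∑ x, α x j) * ∑ y, (1 - α y j) := by
      simp only [a]
      rw [sum_congr rfl fun x _ => sum_comm, sum_comm]
      exact sum_congr rfl fun j _ => (sum_mul_sum _ _ _ _).symm
    have hd' : ∑ x, ∑ y, d x y = ∑ j, δ j * ((∑ x, α x j) * ∑ y, (1 - α y j)) := by
      simp only [d]
      rw [sum_congr rfl fun x _ => sum_comm, sum_comm]
      refine sum_congr rfl fun j _ => ?_
      rw [sum_mul_sum, mul_sum]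
      exact sum_congr rfl fun x _ => (mul_sum _ _ _).symm
    rw [ha', hd', ← sum_sub_distrib, ← sum_sub_distrib]
    exact sum_congr rfl fun j _ => by ring
  have hlow : 16 * (n : ℤ) * t ^ 2 - 8 * ∑ j, (∑ x, if M x j = true then 1 else -1 : ℤ) ^ 2 ≤
      4 * ∑ x, ∑ y, (a x y - d x y - d y x) := by
    rw [hswap]
    calc _ = ∑ j, (16 * (t : ℤ) ^ 2 - 8 * (∑ x, if M x j = true then 1 else -1 : ℤ) ^ 2) := by
          rw [sum_sub_distrib, mul_sum]
          simp
          ring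
      _ ≤ _ := by
          rw [mul_sum]
          exact sum_le_sum fun j _ => hcol j
  have hupp : ∑ x, ∑ y, (a x y - d x y - d y x) ≤
      3 * t * ((∑ x, ∑ y, min (#(V x y)) (#(V y x)) : ℕ) : ℤ) + 48 * t ^ 3 * 2 ^ (4 * t) := by
    refine (sum_le_sum fun x _ => sum_le_sum fun y _ => hmin x y).trans (le_of_eq ?_)
    simp only [sum_add_distrib, ← mul_sum, Nat.cast_sum]
    simp
    ring
  linarith

end BlockPacking

section Antipodal

variable {m n : ℕ} {A B : Fin m → Fin n → Bool}

theorem sum_ite_true_eq_zero {k : ℕ} (p : Fin k → Bool) (hp : 2 * #{i | p i = true} = k) :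
    ∑ i, (if p i = true then 1 else -1 : ℤ) = 0 := by
  have h : ∀ i, (if p i = true then 1 else -1 : ℤ) = 2 * (if p i = true then 1 else 0) - 1 :=
    fun i => by split_ifs <;> simp
  have hp' : (2 : ℤ) * ∑ i, (if p i = true then 1 else 0 : ℤ) = k := by
    rw [card_filter] at hp
    exact_mod_cast hp
  simp only [h, sum_sub_distrib, ← mul_sum, hp']
  simp

theorem sameSums_of_antipodal (hA : HalfRowColSums A) (hB : ∀ i j, B i j = !A i j) :
    SameSums A B := by
  have key : ∀ i j, entryDiff A B i j = if A i j = true then 1 else -1 := fun i j => by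
    cases h : A i j <;> simp [entryDiff, hB, h]
  constructor
  · intro i
    simp only [key]
    exact sum_ite_true_eq_zero _ (hA.1 i)
  · intro j
    simp only [key]
    exact sum_ite_true_eq_zero (fun i => A i j) (hA.2 j)

theorem mismatch_of_antipodal (hB : ∀ i j, B i j = !A i j) : mismatch A B = m * n := by
  simp [mismatch, hB]

/-- Packing directed 4-cycles inside `β` disjoint blocks of `4 * t` rows each. -/
theorem exists_interchangeChain_of_antipodal {t β : ℕ} (ht : 0 < t) (hβ : β * (4 * t) ≤ m)
    (hA : HalfRowColSums A) (hB : ∀ i j, B i j = !A i j) :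
    ∃ k : ℕ, InterchangeChain k A B ∧
      6 * (t : ℤ) * k + β * (4 * n * t ^ 2) ≤
        3 * t * (m * n) + β * (48 * t ^ 3 * 2 ^ (4 * t) + 8 * t * n) := by
  obtain ⟨f, hf⟩ := exists_embedding_sum_sq_le hβ (fun i j => if A i j = true then 1 else -1)
    (fun i j => by split_ifs <;> simp)
    (fun j => sum_ite_true_eq_zero (fun i => A i j) (hA.2 j))
  choose V h1 h2 h3 h4 using fun b : Fin β =>
    exists_block_packing ht (fun x => A (f (b, x))) (fun x => hA.1 _)
  let U : Fin m → Fin m → Finset (Fin n) := fun i i' =>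
    {j | ∃ b x y, f (b, x) = i ∧ f (b, y) = i' ∧ j ∈ V b x y}
  have hU : ∀ i i' j, j ∈ U i i' ↔ ∃ b x y, f (b, x) = i ∧ f (b, y) = i' ∧ j ∈ V b x y := by
    intro i i' j
    simp [U]
  obtain ⟨k, hk, hle⟩ := exists_interchangeChain_of_packing (sameSums_of_antipodal hA hB) U
    (fun i i' j hj => by
      obtain ⟨b, x, y, rfl, rfl, hjV⟩ := (hU _ _ _).1 hj
      have := h1 b x y j hjV
      simp [hB, this])
    (fun i i₁ i₂ j hj₁ hj₂ => by
      obtain ⟨b, x, y, rfl, rfl, hj⟩ := (hU _ _ _).1 hj₁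
      obtain ⟨b', x', y', he, rfl, hj'⟩ := (hU _ _ _).1 hj₂
      obtain ⟨rfl, rfl⟩ := Prod.ext_iff.1 (f.injective he)
      rw [h2 _ _ _ _ _ hj hj'])
    (fun i i₁ i₂ j hj₁ hj₂ => by
      obtain ⟨b, x, y, rfl, rfl, hj⟩ := (hU _ _ _).1 hj₁
      obtain ⟨b', x', y', rfl, he, hj'⟩ := (hU _ _ _).1 hj₂
      obtain ⟨rfl, rfl⟩ := Prod.ext_iff.1 (f.injective he)
      rw [h3 _ _ _ _ _ hj hj'])
  refine ⟨k, hk, ?_⟩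
  have hVU : ∀ b x y, #(V b x y) ≤ #(U (f (b, x)) (f (b, y))) := fun b x y =>
    card_le_card fun j hj => (hU _ _ _).2 ⟨b, x, y, rfl, rfl, hj⟩
  have hsum : ∑ b, ∑ x, ∑ y, min (#(V b x y)) (#(V b y x)) ≤
      ∑ i, ∑ i', min (#(U i i')) (#(U i' i)) := by
    let g : Fin β × Fin (4 * t) × Fin (4 * t) → Fin m × Fin m :=
      fun p => (f (p.1, p.2.1), f (p.1, p.2.2))
    have hg : Function.Injective g := by
      rintro ⟨b, x, y⟩ ⟨b', x', y'⟩ h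
      obtain ⟨e1, e2⟩ := Prod.ext_iff.1 h
      have e3 := f.injective e1
      have e4 := f.injective e2
      simp_all
    calc ∑ b, ∑ x, ∑ y, min (#(V b x y)) (#(V b y x))
        ≤ ∑ b, ∑ x, ∑ y, min (#(U (f (b, x)) (f (b, y)))) (#(U (f (b, y)) (f (b, x)))) :=
          sum_le_sum fun b _ => sum_le_sum fun x _ => sum_le_sum fun y _ =>
            min_le_min (hVU b x y) (hVU b y x)
      _ = ∑ p, min (#(U (g p).1 (g p).2)) (#(U (g p).2 (g p).1)) := by
          simp only [Fintype.sum_prod_type, g]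
      _ = ∑ q ∈ univ.image g, min (#(U q.1 q.2)) (#(U q.2 q.1)) :=
          (sum_image (f := fun q : Fin m × Fin m => min (#(U q.1 q.2)) (#(U q.2 q.1)))
            hg.injOn).symm
      _ ≤ ∑ q : Fin m × Fin m, min (#(U q.1 q.2)) (#(U q.2 q.1)) :=
          sum_le_sum_of_subset (subset_univ _)
      _ = ∑ i, ∑ i', min (#(U i i')) (#(U i' i)) := by
          rw [Fintype.sum_prod_type]
  have hblocks := sum_le_sum fun b (_ : b ∈ univ) => h4 b
  rw [sum_const, sum_add_distrib, sum_add_distrib, sum_const, ← mul_sum, ← mul_sum,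
    ← Nat.cast_sum] at hblocks
  simp only [card_univ, Fintype.card_fin, nsmul_eq_mul] at hblocks
  rw [mismatch_of_antipodal hB] at hle
  have hle' := mul_le_mul_of_nonneg_left hle (by positivity : (0 : ℤ) ≤ 3 * t)
  have hsum' : ((∑ b, ∑ x, ∑ y, min (#(V b x y)) (#(V b y x)) : ℕ) : ℤ) ≤
      ((∑ i, ∑ i', min (#(U i i')) (#(U i' i)) : ℕ) : ℤ) := by exact_mod_cast hsum
  have hsum'' := mul_le_mul_of_nonneg_left hsum' (by positivity : (0 : ℤ) ≤ 3 * t)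
  have hf' : ∑ b, ∑ j, (∑ x, if A (f (b, x)) j = true then 1 else -1 : ℤ) ^ 2 ≤
      β * (4 * t) * n := by exact_mod_cast hf
  linarith

theorem exists_interchangeChain_le_of_large (hm : 2 ^ 220 ≤ m) (hn : 2 ^ 220 ≤ n)
    (hA : HalfRowColSums A) (hB : ∀ i j, B i j = !A i j) :
    ∃ k : ℕ, InterchangeChain k A B ∧ (k : ℝ) ≤ 0.35 * m * n := by
  obtain ⟨k, hk, hle⟩ := exists_interchangeChain_of_antipodal (t := 50) (β := m / 200)
    (by norm_num) (by lia) hA hB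
  refine ⟨k, hk, ?_⟩
  have hβ : (m : ℝ) ≤ 200 * (m / 200 : ℕ) + 200 := by
    exact_mod_cast (by lia : m ≤ 200 * (m / 200) + 200)
  have hm' : (2 : ℝ) ^ 220 ≤ m := by exact_mod_cast hm
  have hn' : (2 : ℝ) ^ 220 ≤ n := by exact_mod_cast hn
  have hle' : 6 * (50 : ℝ) * k + (m / 200 : ℕ) * (4 * n * 50 ^ 2) ≤
      3 * 50 * (m * n) + (m / 200 : ℕ) * (48 * 50 ^ 3 * 2 ^ (4 * 50) + 8 * 50 * n) := by
    exact_mod_cast hle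
  generalize ((m / 200 : ℕ) : ℝ) = β at *
  have hpow : 48 * 50 ^ 3 * (2 : ℝ) ^ (4 * 50) ≤ 100 * n := by
    refine le_trans ?_ (mul_le_mul_of_nonneg_left hn' (by norm_num))
    norm_num
  have hβ' : (0.0049 : ℝ) * m ≤ β := by
    have : (10000 : ℝ) ≤ 2 ^ 220 := by norm_num
    linarith
  have hβ0 : 0 ≤ β := le_trans (by positivity) hβ'
  have h1 : β * (48 * 50 ^ 3 * 2 ^ (4 * 50)) ≤ β * (100 * n) :=
    mul_le_mul_of_nonneg_left hpow hβ0
  have h2 : 0.0049 * m * n ≤ β * n := mul_le_mul_of_nonneg_right hβ' (Nat.cast_nonneg n)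
  nlinarith

end Antipodal


/-- For every `ε > 0` there exists `N` such that for all even `m, n` with `min{m,n} ≥ N`:
if `A` and `B` are antipodal matrices of `𝒜(R,S)` (i.e. `A + B` is the all-one matrix, every
row sum is `n/2` and every column sum is `m/2`), then the distance `i(A,B)` in the interchange
graph satisfies `mn/4 ≤ i(A,B) ≤ ((1+√2)/(4+√8))·mn·(1+ε)`; i.e. there is a walk from `A`
to `B` of length at most `((1+√2)/(4+√8))·mn·(1+ε)`, and every walk from `A` to `B` has
length at least `mn/4`. -/
theorem distance_antipodal_interchange :
    ∀ ε : ℝ, 0 < ε → ∃ N : ℕ, ∀ m n : ℕ, Even m → Even n → N ≤ min m n →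
      ∀ A B : Fin m → Fin n → Bool, HalfRowColSums A →
        (∀ i : Fin m, ∀ j : Fin n, B i j = !A i j) →
        (∃ k : ℕ, InterchangeChain k A B ∧
          (k : ℝ) ≤ ((1 + Real.sqrt 2) / (4 + Real.sqrt 8)) * m * n * (1 + ε)) ∧
        (∀ k : ℕ, InterchangeChain k A B → (m : ℝ) * n / 4 ≤ k) := by
  intro ε hε
  refine ⟨2 ^ 220, fun m n _ _ hN A B hA hB => ⟨?_, fun k hk => ?_⟩⟩
  · obtain ⟨k, hk, hle⟩ := exists_interchangeChain_le_of_large (hN.trans (min_le_left m n))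
      (hN.trans (min_le_right m n)) hA hB
    refine ⟨k, hk, hle.trans ?_⟩
    have h8 : Real.sqrt 8 = 2 * Real.sqrt 2 := by
      rw [show (8 : ℝ) = 2 ^ 2 * 2 by norm_num, Real.sqrt_mul (by norm_num),
        Real.sqrt_sq (by norm_num)]
    have h2 : (1.4 : ℝ) ≤ Real.sqrt 2 := Real.le_sqrt_of_sq_le (by norm_num)
    have hc : (0.35 : ℝ) ≤ (1 + Real.sqrt 2) / (4 + Real.sqrt 8) := by
      rw [h8, le_div_iff₀ (by positivity)]
      linarith
    have hmn : (0 : ℝ) ≤ (1 + Real.sqrt 2) / (4 + Real.sqrt 8) * m * n := by positivity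
    calc (0.35 : ℝ) * m * n ≤ (1 + Real.sqrt 2) / (4 + Real.sqrt 8) * m * n := by gcongr
      _ ≤ (1 + Real.sqrt 2) / (4 + Real.sqrt 8) * m * n * (1 + ε) :=
        le_mul_of_one_le_right hmn (by linarith)
  · have h := hk.mismatch_le
    rw [mismatch_of_antipodal hB] at h
    have h' : (m : ℝ) * n ≤ 4 * k := by exact_mod_cast h
    linarith
end

section
/- For every ε > 0 there exist δ > 0 and M such that for all integers m, n with M ≤ m ≤ n, every δ-Eulerian orientation of K_{m,n} contains at least (1/(4+√8))·mn·(1−ε) pairwise arc-disjoint directed 4-cycles. -/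
open Finset

/-- A `δ`-Eulerian orientation of `K_{m,n}`: every vertex of the class of size `m` has
outdegree and indegree at least `(1−δ)·n/2`, and every vertex of the class of size `n` has
outdegree and indegree at least `(1−δ)·m/2`.  Here `o a b = true` means the edge between
left vertex `a` and right vertex `b` is directed from `a` to `b`. -/
def IsDeltaEulerianBip {m n : ℕ} (δ : ℝ) (o : Fin m → Fin n → Bool) : Prop :=
  (∀ a : Fin m,
    (1 - δ) * n / 2 ≤ ((univ.filter fun b : Fin n => o a b = true).card : ℝ) ∧
    (1 - δ) * n / 2 ≤ ((univ.filter fun b : Fin n => o a b = false).card : ℝ)) ∧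
  (∀ b : Fin n,
    (1 - δ) * m / 2 ≤ ((univ.filter fun a : Fin m => o a b = true).card : ℝ) ∧
    (1 - δ) * m / 2 ≤ ((univ.filter fun a : Fin m => o a b = false).card : ℝ))

/-- The sign `±1` recording the direction of an edge. -/
def dirSign (x : Bool) : ℝ := if x then 1 else -1

lemma exists_bijOn_Iio_card {β : Type*} (B : Finset β) :
    ∃ e : β → ℕ, Set.BijOn e B (Set.Iio B.card) := by
  classical
  refine ⟨fun b => if h : b ∈ B then (B.equivFin ⟨b, h⟩ : ℕ) else 0, ?_, ?_, ?_⟩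
  · intro b hb
    have hb' : b ∈ B := hb
    simp [hb']
  · intro b hb c hc h
    have hb' : b ∈ B := hb
    have hc' : c ∈ B := hc
    simp only [hb', hc', dif_pos] at h
    simpa using B.equivFin.injective (Fin.ext h)
  · intro k hk
    refine ⟨B.equivFin.symm ⟨k, hk⟩, (B.equivFin.symm ⟨k, hk⟩).2, ?_⟩
    simp

lemma exists_equidistributed {β : Type*} (B : Finset β) (L : ℕ) :
    ∃ ρ : β → ℕ, ∀ r < L, B.card / L ≤ (B.filter fun b => ρ b = r).card := by
  obtain ⟨e, -, -, he⟩ := exists_bijOn_Iio_card B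
  refine ⟨fun b => e b % L, fun r hr => ?_⟩
  have key : Set.SurjOn (fun b => e b / L) (B.filter fun b => e b % L = r)
      (range (B.card / L)) := by
    intro k hk
    have hk' : k < B.card / L := by simpa using hk
    have hlt : r + L * k < B.card := by
      have h1 : L * (k + 1) ≤ L * (B.card / L) := Nat.mul_le_mul_left _ hk'
      have h2 := Nat.mul_div_le B.card L
      rw [mul_add] at h1
      omega
    obtain ⟨b, hb, hbe⟩ := he hlt
    refine ⟨b, ?_, ?_⟩
    · have hb' : b ∈ B := hb
      simp [hb', hbe, Nat.mod_eq_of_lt hr]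
    · have hL : 0 < L := by omega
      simp [hbe, Nat.add_mul_div_left _ _ hL, Nat.div_eq_of_lt hr]
  simpa using card_le_card_of_surjOn _ key

/-- A proper edge colouring of the complete bipartite graph between the `true` and the `false`
points of `τ`, with as many colours as the larger side. -/
lemma exists_proper_coloring {ι : Type*} [Fintype ι] (τ : ι → Bool) (L : ℕ)
    (hT : (univ.filter fun i => τ i = true).card ≤ L)
    (hF : (univ.filter fun i => τ i = false).card ≤ L) :
    ∃ c : ι → ι → ℕ,
      (∀ i j, τ i = true → τ j = false → c i j < L) ∧
      (∀ i j j', τ i = true → τ j = false → τ j' = false → c i j = c i j' → j = j') ∧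
      (∀ i i' j, τ i = true → τ i' = true → τ j = false → c i j = c i' j → i = i') := by
  obtain ⟨u, hu, hui, -⟩ := exists_bijOn_Iio_card (univ.filter fun i => τ i = true)
  obtain ⟨v, hv, hvi, -⟩ := exists_bijOn_Iio_card (univ.filter fun i => τ i = false)
  have hu' : ∀ i, τ i = true → u i < L := fun i hi =>
    lt_of_lt_of_le (hu (by simpa using hi)) hT
  have hv' : ∀ i, τ i = false → v i < L := fun i hi =>
    lt_of_lt_of_le (hv (by simpa using hi)) hF
  refine ⟨fun i j => (u i + v j) % L, ?_, ?_, ?_⟩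
  · intro i j hi hj
    exact Nat.mod_lt _ (by have := hu' i hi; omega)
  · intro i j j' hi hj hj' h
    apply hvi (by simpa using hj) (by simpa using hj')
    have h1 : v j ≡ v j' [MOD L] := Nat.ModEq.add_left_cancel' (u i) h
    exact Nat.ModEq.eq_of_lt_of_lt h1 (hv' j hj) (hv' j' hj')
  · intro i i' j hi hi' hj h
    apply hui (by simpa using hi) (by simpa using hi')
    have h1 : u i ≡ u i' [MOD L] := Nat.ModEq.add_right_cancel' (v j) h
    exact Nat.ModEq.eq_of_lt_of_lt h1 (hu' i hi) (hu' i' hi')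

/-- The size of the larger of the two sides of a column. -/
def majority {ι : Type*} [Fintype ι] (τ : ι → Bool) : ℕ :=
  max (univ.filter fun i => τ i = true).card (univ.filter fun i => τ i = false).card

open Classical in
/-- In each column one can choose a matching between its `true` and its `false` rows so that every
pair of rows gets close to its fair share of the columns in which it differs. -/
lemma exists_fair_matchings {ι β : Type*} [Fintype ι] [Fintype β] (o : ι → β → Bool) :
    ∃ P : ι → ι → β → Prop,
      (∀ i j b, P i j b → o i b = true ∧ o j b = false) ∧
      (∀ i j j' b, P i j b → P i j' b → j = j') ∧
      (∀ i i' j b, P i j b → P i' j b → i = i') ∧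
      ∀ i j, ∑ b with o i b = true ∧ o j b = false, 1 / (majority (fun k => o k b) : ℝ)
        - 2 ^ Fintype.card ι ≤ (univ.filter fun b => P i j b).card := by
  choose c hc1 hc2 hc3 using fun τ : ι → Bool =>
    exists_proper_coloring τ (majority τ) (le_max_left _ _) (le_max_right _ _)
  choose ρ hρ using fun τ : ι → Bool =>
    exists_equidistributed (univ.filter fun b => (fun k => o k b) = τ) (majority τ)
  refine ⟨fun i j b => (o i b = true ∧ o j b = false) ∧
    ρ (fun k => o k b) b = c (fun k => o k b) i j, fun i j b h => h.1, ?_, ?_, ?_⟩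
  · rintro i j j' b ⟨⟨h1, h2⟩, h3⟩ ⟨⟨-, h4⟩, h5⟩
    exact hc2 (fun k => o k b) i j j' h1 h2 h4 (h3.symm.trans h5)
  · rintro i i' j b ⟨⟨h1, h2⟩, h3⟩ ⟨⟨h4, -⟩, h5⟩
    exact hc3 (fun k => o k b) i i' j h1 h4 h2 (h3.symm.trans h5)
  · intro i j
    rw [← sum_fiberwise _ (fun b => fun k => o k b),
      card_eq_sum_card_fiberwise (f := fun b => fun k => o k b) (t := univ) (by simp)]
    have hcard : (2 : ℝ) ^ Fintype.card ι = ∑ _τ : ι → Bool, (1 : ℝ) := by simp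
    rw [hcard, ← sum_sub_distrib, Nat.cast_sum]
    refine sum_le_sum fun τ _ => ?_
    by_cases hτ : τ i = true ∧ τ j = false
    · have hlt := hc1 τ i j hτ.1 hτ.2
      have h1 := hρ τ _ hlt
      refine le_trans ?_ (Nat.cast_le.2 (h1.trans (card_le_card fun b hb => ?_)))
      swap
      · simp only [mem_filter, mem_univ, true_and] at hb ⊢
        obtain ⟨rfl, h⟩ := hb
        exact ⟨⟨hτ, h⟩, rfl⟩
      have hL : (0 : ℝ) < majority τ := by
        have : 0 < majority τ := by omega
        exact_mod_cast this
      have h3 : ∑ b ∈ ({b | o i b = true ∧ o j b = false} : Finset β) with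
          (fun k => o k b) = τ, 1 / (majority (fun k => o k b) : ℝ) ≤
          ((univ.filter fun b => (fun k => o k b) = τ).card : ℝ) / majority τ := by
        rw [sum_congr rfl (g := fun _ => 1 / (majority τ : ℝ))
          (by intro b hb; rw [(mem_filter.1 hb).2]), sum_const, nsmul_eq_mul, mul_one_div]
        gcongr
        simp
      have h4 : ((univ.filter fun b => (fun k => o k b) = τ).card : ℝ) / majority τ - 1 ≤
          ((univ.filter fun b => (fun k => o k b) = τ).card / majority τ : ℕ) := by
        rw [sub_le_iff_le_add, ← Nat.floor_div_eq_div (K := ℝ)]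
        exact (Nat.lt_floor_add_one _).le
      linarith
    · rw [sum_eq_zero]
      · refine le_trans ?_ (Nat.cast_nonneg _)
        norm_num
      · intro b hb
        simp only [mem_filter, mem_univ, true_and] at hb
        obtain ⟨h, rfl⟩ := hb
        exact absurd h hτ

lemma dirSign_mul_self (x : Bool) : dirSign x * dirSign x = 1 := by
  cases x <;> simp [dirSign]

lemma sum_dirSign {ι : Type*} [Fintype ι] (f : ι → Bool) :
    ∑ i, dirSign (f i) = ((univ.filter fun i => f i = true).card : ℝ) -
      (univ.filter fun i => f i = false).card := by
  simp only [dirSign, sum_ite, sum_const, nsmul_eq_mul, mul_one, mul_neg, Bool.not_eq_true]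
  ring

lemma card_true_add_card_false {ι : Type*} [Fintype ι] (f : ι → Bool) :
    ((univ.filter fun i => f i = true).card : ℝ) + (univ.filter fun i => f i = false).card =
      Fintype.card ι := by
  have := card_filter_add_card_filter_not (s := (univ : Finset ι)) (fun i => f i = true)
  simp only [Bool.not_eq_true, card_univ] at this
  exact_mod_cast this

lemma one_div_majority_ge {ι : Type*} [Fintype ι] (hι : Fintype.card ι = 100) (τ : ι → Bool) :
    19 / 1000 - (∑ i, dirSign (τ i)) ^ 2 / 100000 ≤ 1 / (majority τ : ℝ) := by
  have h1 := card_true_add_card_false τ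
  rw [sum_dirSign]
  rw [hι] at h1
  unfold majority
  rw [Nat.cast_max]
  set T : ℝ := ((univ.filter fun i => τ i = true).card : ℝ)
  set F : ℝ := ((univ.filter fun i => τ i = false).card : ℝ)
  push_cast at h1
  have aux : ∀ x y : ℝ, x + y = 100 → y ≤ x → 19 / 1000 - (x - y) ^ 2 / 100000 ≤ 1 / x := by
    intro x y h hxy
    have hx : 0 < x := by linarith
    obtain ⟨d, rfl⟩ : ∃ d, x = 50 + d / 2 := ⟨2 * x - 100, by ring⟩
    obtain rfl : y = 50 - d / 2 := by linarith
    have hd : 0 ≤ d := by linarith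
    rw [le_div_iff₀ hx]
    nlinarith [pow_nonneg hd 3, sq_nonneg (d - 10)]
  rcases le_total F T with h | h
  · rw [max_eq_left h]
    exact aux T F h1 h
  · rw [max_eq_right h]
    have := aux F T (by linarith) h
    rwa [← neg_sub T F, neg_sq] at this

lemma exists_injective_pairing {β : Type*} (A B : Finset β) :
    ∃ R : Finset (β × β), (∀ x ∈ R, x.1 ∈ A ∧ x.2 ∈ B) ∧ R.card = min A.card B.card ∧
      (∀ x ∈ R, ∀ y ∈ R, x.1 = y.1 → x = y) ∧ (∀ x ∈ R, ∀ y ∈ R, x.2 = y.2 → x = y) := by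
  classical
  let f : Fin (min A.card B.card) → β × β := fun k =>
    (A.equivFin.symm (Fin.castLE (min_le_left _ _) k),
      B.equivFin.symm (Fin.castLE (min_le_right _ _) k))
  have h1 : ∀ k l, (f k).1 = (f l).1 → k = l := by
    intro k l h
    simpa [f] using h
  have h2 : ∀ k l, (f k).2 = (f l).2 → k = l := by
    intro k l h
    simpa [f] using h
  refine ⟨univ.image f, ?_, ?_, ?_, ?_⟩
  · simp [f]
  · rw [card_image_of_injective _ fun k l h => h1 k l (congrArg Prod.fst h)]
    simp
  · simp only [mem_image, mem_univ, true_and]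
    rintro _ ⟨k, rfl⟩ _ ⟨l, rfl⟩ h
    rw [h1 k l h]
  · simp only [mem_image, mem_univ, true_and]
    rintro _ ⟨k, rfl⟩ _ ⟨l, rfl⟩ h
    rw [h2 k l h]

open Classical in
/-- Matchings chosen in the columns assemble into arc-disjoint directed 4-cycles. -/
lemma exists_C4_packing_of_matchings {m n : ℕ} (o : Fin m → Fin n → Bool)
    (P : Fin m → Fin m → Fin n → Prop)
    (ho : ∀ a a' b, P a a' b → o a b = true ∧ o a' b = false)
    (hr : ∀ a a' a'' b, P a a' b → P a a'' b → a' = a'')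
    (hl : ∀ a a' a'' b, P a a'' b → P a' a'' b → a = a') :
    ∃ S : Finset (Fin m × Fin m × Fin n × Fin n),
      (∀ q ∈ S, IsDirC4 o q) ∧
      (∀ q ∈ S, ∀ q' ∈ S, q ≠ q' → Disjoint (c4Arcs q) (c4Arcs q')) ∧
      ∑ a, ∑ a', min (univ.filter fun b => P a a' b).card (univ.filter fun b => P a' a b).card
        ≤ 2 * S.card := by
  choose R hRm hRc hR1 hR2 using fun a a' : Fin m =>
    exists_injective_pairing (univ.filter fun b => P a a' b) (univ.filter fun b => P a' a b)
  simp only [mem_filter, mem_univ, true_and] at hRm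
  have hshare : ∀ x a a' c c' b, P a a' b → P c c' b → (x = a ∨ x = a') → (x = c ∨ x = c') →
      a = c ∧ a' = c' := by
    intro x a a' c c' b h1 h2 h3 h4
    obtain ⟨h5, h6⟩ := ho _ _ _ h1
    obtain ⟨h7, h8⟩ := ho _ _ _ h2
    rcases h3 with rfl | rfl <;> rcases h4 with rfl | rfl
    · exact ⟨rfl, hr _ _ _ _ h1 h2⟩
    · exact Bool.noConfusion (h5.symm.trans h8)
    · exact Bool.noConfusion (h7.symm.trans h6)
    · exact ⟨hl _ _ _ _ h1 h2, rfl⟩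
  refine ⟨univ.filter fun q => q.1 < q.2.1 ∧ q.2.2 ∈ R q.1 q.2.1, ?_, ?_, ?_⟩
  · rintro ⟨a, a', b, b'⟩ hq
    simp only [mem_filter, mem_univ, true_and] at hq
    obtain ⟨h1, h2⟩ := hRm _ _ _ hq.2
    have h3 := ho _ _ _ h1
    have h4 := ho _ _ _ h2
    refine ⟨hq.1.ne, ?_, h3.1, h3.2, h4.1, h4.2⟩
    intro h
    have h5 : o a b = o a b' := congrArg (o a) h
    rw [h3.1, h4.2] at h5
    exact Bool.noConfusion h5
  · rintro ⟨a, a', b, b'⟩ hq ⟨c, c', d, d'⟩ hq' hne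
    simp only [mem_filter, mem_univ, true_and] at hq hq'
    obtain ⟨h1, h2⟩ := hRm _ _ _ hq.2
    obtain ⟨h3, h4⟩ := hRm _ _ _ hq'.2
    by_contra hdis
    obtain ⟨⟨x, y⟩, hx, hx'⟩ := not_disjoint_iff.1 hdis
    have arcs : ∀ a a' : Fin m, ∀ b b' : Fin n, (x, y) ∈ c4Arcs (a, a', b, b') →
        (x = a ∨ x = a') ∧ (y = b ∨ y = b') := by
      intro a a' b b' h
      simp only [c4Arcs, mem_insert, mem_singleton, Prod.mk.injEq] at h
      tauto
    obtain ⟨hxa, hyb⟩ := arcs _ _ _ _ hx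
    obtain ⟨hxc, hyd⟩ := arcs _ _ _ _ hx'
    apply hne
    rcases hyb with rfl | rfl <;> rcases hyd with rfl | rfl
    · obtain ⟨rfl, rfl⟩ := hshare x _ _ _ _ _ h1 h3 hxa hxc
      rw [hR1 _ _ _ hq.2 _ hq'.2 rfl]
    · obtain ⟨rfl, rfl⟩ := hshare x _ _ _ _ _ h1 h4 hxa hxc.symm
      exact absurd hq.1 hq'.1.not_gt
    · obtain ⟨rfl, rfl⟩ := hshare x _ _ _ _ _ h2 h3 hxa.symm hxc
      exact absurd hq.1 hq'.1.not_gt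
    · obtain ⟨rfl, rfl⟩ := hshare x _ _ _ _ _ h2 h4 hxa.symm hxc.symm
      rw [hR2 _ _ _ hq.2 _ hq'.2 rfl]
  · set f : Fin m → Fin m → ℕ := fun a a' =>
      min (univ.filter fun b => P a a' b).card (univ.filter fun b => P a' a b).card with hf
    have hcard : (univ.filter fun q : Fin m × Fin m × Fin n × Fin n =>
        q.1 < q.2.1 ∧ q.2.2 ∈ R q.1 q.2.1).card =
        ∑ a, ∑ a', if a < a' then f a a' else 0 := by
      rw [card_filter, Fintype.sum_prod_type]
      refine sum_congr rfl fun a _ => ?_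
      rw [Fintype.sum_prod_type]
      refine sum_congr rfl fun a' _ => ?_
      by_cases h : a < a'
      · simp [h, hf, ← hRc]
      · simp [h]
    have hsymm : ∑ a, ∑ a', (if a' < a then f a a' else 0) =
        ∑ a, ∑ a', if a < a' then f a a' else 0 := by
      rw [sum_comm]
      refine sum_congr rfl fun a _ => sum_congr rfl fun a' _ => ?_
      simp only [hf, min_comm]
    rw [hcard, two_mul]
    nth_rewrite 2 [← hsymm]
    simp only [← sum_add_distrib]
    refine sum_le_sum fun a _ => sum_le_sum fun a' _ => ?_
    rcases lt_trichotomy a a' with h | rfl | h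
    · change f a a' ≤ _
      simp [h]
    · have : ∀ b, ¬ P a a b := fun b hb =>
        Bool.noConfusion ((ho _ _ _ hb).1.symm.trans (ho _ _ _ hb).2)
      simp [this]
    · change f a a' ≤ _
      simp [h]

lemma sq_sum_eq_card_add_sum_offDiag {ι : Type*} [Fintype ι] [DecidableEq ι] (f : ι → Bool) :
    (∑ i, dirSign (f i)) ^ 2 =
      Fintype.card ι + ∑ p ∈ univ.offDiag, dirSign (f p.1) * dirSign (f p.2) := by
  rw [sq, sum_mul_sum, ← sum_product', ← diag_union_offDiag, sum_union (disjoint_diag_offDiag _),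
    sum_diag]
  simp [dirSign_mul_self]

open Classical in
lemma min_matching_counts_ge {ι β : Type*} [Fintype ι] [Fintype β]
    (hι : Fintype.card ι = 100) (o : ι → β → Bool)
    (ho : ∀ i, |∑ b, dirSign (o i b)| ≤ Fintype.card β / 100) (P : ι → ι → β → Prop)
    (hP : ∀ i j, ∑ b with o i b = true ∧ o j b = false, 1 / (majority (fun k => o k b) : ℝ)
        - 2 ^ Fintype.card ι ≤ (univ.filter fun b => P i j b).card) :
    4655 / 100 * (Fintype.card β : ℝ) - 5475 / 100000 * ∑ b, (∑ i, dirSign (o i b)) ^ 2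
        - 10000 * 2 ^ 100 ≤
      ((∑ i, ∑ j, min (univ.filter fun b => P i j b).card
        (univ.filter fun b => P j i b).card : ℕ) : ℝ) := by
  set D : β → ℝ := fun b => ∑ i, dirSign (o i b)
  set W : ι → ι → ℝ := fun i j =>
    ∑ b, (1 - dirSign (o i b) * dirSign (o j b)) / 2 * (95 / 10000 - D b ^ 2 / 100000)
  have hWsymm : ∀ i j, W i j = W j i := by
    intro i j
    refine sum_congr rfl fun b _ => ?_
    ring
  have hpoint : ∀ (x y : Bool) (d : ℝ), 0 ≤ d →
      (1 - dirSign x * dirSign y) / 2 * (95 / 10000 - d / 100000) +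
        19 / 4000 * (dirSign x - dirSign y) ≤
      if x = true ∧ y = false then 19 / 1000 - d / 100000 else 0 := by
    intro x y d hd
    cases x <;> cases y <;> simp [dirSign] <;> linarith
  have hN : ∀ i j, W i j - 95 / 1000000 * (Fintype.card β : ℝ) - 2 ^ 100 ≤
      (univ.filter fun b => P i j b).card := by
    intro i j
    have h1 : W i j + 19 / 4000 * (∑ b, dirSign (o i b) - ∑ b, dirSign (o j b)) ≤
        ∑ b with o i b = true ∧ o j b = false, 1 / (majority (fun k => o k b) : ℝ) := by
      calc _ = ∑ b, ((1 - dirSign (o i b) * dirSign (o j b)) / 2 *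
            (95 / 10000 - D b ^ 2 / 100000) +
            19 / 4000 * (dirSign (o i b) - dirSign (o j b))) := by
            rw [sum_add_distrib, ← mul_sum, sum_sub_distrib]
        _ ≤ ∑ b, if o i b = true ∧ o j b = false then 19 / 1000 - D b ^ 2 / 100000 else 0 :=
            sum_le_sum fun b _ => hpoint _ _ _ (sq_nonneg _)
        _ = ∑ b with o i b = true ∧ o j b = false, (19 / 1000 - D b ^ 2 / 100000) := by
            rw [sum_filter]
        _ ≤ _ := sum_le_sum fun b _ => one_div_majority_ge hι fun k => o k b
    have h2 := hP i j
    rw [hι] at h2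
    have h3 := abs_le.1 (ho i)
    have h4 := abs_le.1 (ho j)
    linarith [h3.1, h4.2]
  have hsum : ∑ i, ∑ j, W i j =
      ∑ b, (10000 - D b ^ 2) / 2 * (95 / 10000 - D b ^ 2 / 100000) := by
    have : ∀ b, ∑ i, ∑ j, (1 - dirSign (o i b) * dirSign (o j b)) / 2 *
        (95 / 10000 - D b ^ 2 / 100000) =
        (10000 - D b ^ 2) / 2 * (95 / 10000 - D b ^ 2 / 100000) := by
      intro b
      simp only [← sum_mul, ← sum_div, sum_sub_distrib, ← mul_sum]
      simp only [sum_const, card_univ, hι, nsmul_eq_mul]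
      norm_num
      left
      ring
    rw [← sum_congr rfl fun b _ => this b]
    exact (sum_congr rfl fun i _ => sum_comm).trans sum_comm
  have hlow : ∑ b : β, (475 / 10 - 5475 / 100000 * D b ^ 2) ≤ ∑ i, ∑ j, W i j := by
    rw [hsum]
    refine sum_le_sum fun b _ => ?_
    nlinarith [sq_nonneg (D b ^ 2)]
  have htot : ∑ i, ∑ j, (W i j - 95 / 1000000 * (Fintype.card β : ℝ) - 2 ^ 100) ≤
      ((∑ i, ∑ j, min (univ.filter fun b => P i j b).card
        (univ.filter fun b => P j i b).card : ℕ) : ℝ) := by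
    push_cast
    refine sum_le_sum fun i _ => sum_le_sum fun j _ => le_min (hN i j) ?_
    rw [hWsymm]
    exact hN j i
  simp only [sum_sub_distrib, sum_const, card_univ, hι, nsmul_eq_mul, ← mul_sum] at hlow htot
  push_cast at hlow htot ⊢
  linarith

lemma exists_perm_sum_le_average {α γ : Type*} [Fintype α] [DecidableEq α] (G : α → α → ℝ)
    (T : Finset γ) (u v : γ → α) (huv : ∀ t ∈ T, u t ≠ v t) :
    ∃ π : Equiv.Perm α, ((univ : Finset α).offDiag.card : ℝ) * ∑ t ∈ T, G (π (u t)) (π (v t)) ≤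
      T.card * ∑ p ∈ univ.offDiag, G p.1 p.2 := by
  have hconst : ∀ a b a' b' : α, a ≠ b → a' ≠ b' →
      ∑ π : Equiv.Perm α, G (π a) (π b) = ∑ π : Equiv.Perm α, G (π a') (π b') := by
    intro a b a' b' h h'
    obtain ⟨σ, h1, h2⟩ := (MulAction.is_two_pretransitive_iff (G := Equiv.Perm α)).1
      (Equiv.Perm.isMultiplyPretransitive α 2) h' h
    rw [← _root_.Equiv.sum_comp (Equiv.mulRight σ) fun π : Equiv.Perm α => G (π a') (π b')]
    simp only [Equiv.Perm.smul_def] at h1 h2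
    simp [h1, h2]
  have hoff : ∀ π : Equiv.Perm α, ∑ p ∈ univ.offDiag, G (π p.1) (π p.2) =
      ∑ p ∈ univ.offDiag, G p.1 p.2 := by
    intro π
    refine sum_equiv (π.prodCongr π) (by simp) (by simp)
  have hA : ∀ t ∈ T, ((univ : Finset α).offDiag.card : ℝ) *
      ∑ π : Equiv.Perm α, G (π (u t)) (π (v t)) =
      ∑ _π : Equiv.Perm α, ∑ p ∈ univ.offDiag, G p.1 p.2 := by
    intro t ht
    have h : ∀ p ∈ (univ : Finset α).offDiag, ∑ π : Equiv.Perm α, G (π p.1) (π p.2) =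
        ∑ π : Equiv.Perm α, G (π (u t)) (π (v t)) := fun p hp =>
      hconst _ _ _ _ (by simpa using hp) (huv t ht)
    rw [← sum_congr rfl fun π _ => hoff π, sum_comm, sum_congr rfl h, sum_const, nsmul_eq_mul]
  obtain ⟨π, -, hπ⟩ := exists_le_of_sum_le (s := (univ : Finset (Equiv.Perm α)))
    (f := fun π => ((univ : Finset α).offDiag.card : ℝ) * ∑ t ∈ T, G (π (u t)) (π (v t)))
    (g := fun _ => T.card * ∑ p ∈ univ.offDiag, G p.1 p.2) univ_nonempty (by
      rw [← mul_sum, sum_comm, mul_sum, sum_congr rfl hA, ← mul_sum]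
      simp)
  exact ⟨π, hπ⟩

/-- By averaging over permutations, rows can be grouped into blocks in which the columns are
nearly balanced in mean square. -/
lemma exists_balanced_blocks {κ ι : Type*} [Fintype κ] [Fintype ι] {m n : ℕ} (hm : 2 ≤ m)
    (hι : Fintype.card ι = 100) (o : Fin m → Fin n → Bool)
    (ho : ∀ b, |∑ a, dirSign (o a b)| ≤ m / 100) (φ : κ × ι ↪ Fin m) :
    ∃ ψ : κ × ι ↪ Fin m, ∑ q, ∑ b, (∑ i, dirSign (o (ψ (q, i)) b)) ^ 2 ≤
      101 * (Fintype.card κ : ℝ) * n := by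
  classical
  set G : Fin m → Fin m → ℝ := fun a a' => ∑ b, dirSign (o a b) * dirSign (o a' b) with hG
  obtain ⟨π, hπ⟩ := exists_perm_sum_le_average G
    ((univ : Finset κ) ×ˢ (univ : Finset ι).offDiag)
    (fun t => φ (t.1, t.2.1)) (fun t => φ (t.1, t.2.2)) (by
      rintro ⟨q, i, j⟩ h
      simpa using h)
  refine ⟨φ.trans π.toEmbedding, ?_⟩
  have hm' : (2 : ℝ) ≤ m := by exact_mod_cast hm
  have hoff : ∑ p ∈ univ.offDiag, G p.1 p.2 ≤ n * (m * (m - 1) / 10000 : ℝ) := by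
    rw [hG, sum_comm]
    calc _ ≤ ∑ _b : Fin n, (m * (m - 1) / 10000 : ℝ) := sum_le_sum fun b _ => ?_
      _ = _ := by simp
    have h1 := sq_sum_eq_card_add_sum_offDiag fun a => o a b
    have h2 := sq_le_sq' (abs_le.1 (ho b)).1 (abs_le.1 (ho b)).2
    rw [Fintype.card_fin] at h1
    nlinarith
  have hcard : ((univ : Finset (Fin m)).offDiag.card : ℝ) = m * (m - 1) := by
    rw [offDiag_card, card_univ, Fintype.card_fin, Nat.cast_sub (Nat.le_mul_self m)]
    push_cast
    ring
  have hT : (((univ : Finset κ) ×ˢ (univ : Finset ι).offDiag).card : ℝ) =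
      Fintype.card κ * 9900 := by
    rw [card_product, offDiag_card, card_univ, card_univ, hι]
    push_cast
    norm_num
  have hblock : ∑ q, ∑ b, (∑ i, dirSign (o ((φ.trans π.toEmbedding) (q, i)) b)) ^ 2 =
      100 * (Fintype.card κ : ℝ) * n + ∑ t ∈ (univ : Finset κ) ×ˢ (univ : Finset ι).offDiag,
        G (π (φ (t.1, t.2.1))) (π (φ (t.1, t.2.2))) := by
    simp only [sq_sum_eq_card_add_sum_offDiag fun i => o ((φ.trans π.toEmbedding) (_, i)) _,
      sum_add_distrib, sum_product, hG]
    congr 1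
    · simp [hι]
      ring
    · refine sum_congr rfl fun q _ => ?_
      rw [sum_comm]
      rfl
  rw [hblock]
  rw [hcard, hT] at hπ
  have hpos : (0 : ℝ) < m * (m - 1) := by nlinarith
  have h1 : (m * (m - 1) : ℝ) * ∑ t ∈ (univ : Finset κ) ×ˢ (univ : Finset ι).offDiag,
        G (π (φ (t.1, t.2.1))) (π (φ (t.1, t.2.2))) ≤
      (m * (m - 1)) * (Fintype.card κ * n) := by
    refine hπ.trans ?_
    have h2 := mul_le_mul_of_nonneg_left hoff
      (by positivity : (0 : ℝ) ≤ Fintype.card κ * 9900)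
    have h3 : (0 : ℝ) ≤ (m * (m - 1)) * (Fintype.card κ * n) := by positivity
    linarith
  have h2 := le_of_mul_le_mul_left h1 hpos
  linarith

open Classical in
/-- A partition of the rows into blocks of size `100` in which most columns are nearly balanced
yields a large packing. -/
lemma exists_C4_packing_of_blocks {κ ι : Type*} [Fintype κ] [Fintype ι] {m n : ℕ}
    (hι : Fintype.card ι = 100) (o : Fin m → Fin n → Bool)
    (ho : ∀ a, |∑ b, dirSign (o a b)| ≤ n / 100) (ψ : κ × ι ↪ Fin m)
    (hψ : ∑ q, ∑ b, (∑ i, dirSign (o (ψ (q, i)) b)) ^ 2 ≤ 101 * (Fintype.card κ : ℝ) * n) :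
    ∃ S : Finset (Fin m × Fin m × Fin n × Fin n),
      (∀ q ∈ S, IsDirC4 o q) ∧
      (∀ q ∈ S, ∀ q' ∈ S, q ≠ q' → Disjoint (c4Arcs q) (c4Arcs q')) ∧
      Fintype.card κ * (41 * n - 10000 * 2 ^ 100 : ℝ) ≤ 2 * S.card := by
  choose P hP hPr hPl hPc using fun q : κ => exists_fair_matchings fun (i : ι) b => o (ψ (q, i)) b
  obtain ⟨S, hS, hdis, hcard⟩ := exists_C4_packing_of_matchings o
    (fun a a' b => ∃ q i j, ψ (q, i) = a ∧ ψ (q, j) = a' ∧ P q i j b)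
    (by
      rintro _ _ b ⟨q, i, j, rfl, rfl, h⟩
      exact hP _ _ _ _ h)
    (by
      rintro _ _ _ b ⟨q, i, j, rfl, rfl, h⟩ ⟨q', i', j', h1, rfl, h'⟩
      obtain ⟨rfl, rfl⟩ := Prod.mk.inj (ψ.injective h1)
      rw [hPr _ _ _ _ _ h h'])
    (by
      rintro _ _ _ b ⟨q, i, j, rfl, rfl, h⟩ ⟨q', i', j', rfl, h1, h'⟩
      obtain ⟨rfl, rfl⟩ := Prod.mk.inj (ψ.injective h1)
      rw [hPl _ _ _ _ _ h h'])
  refine ⟨S, hS, hdis, ?_⟩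
  set N : Fin m → Fin m → ℕ := fun a a' =>
    (univ.filter fun b => ∃ q i j, ψ (q, i) = a ∧ ψ (q, j) = a' ∧ P q i j b).card
  have hinj : Function.Injective fun t : κ × ι × ι => (ψ (t.1, t.2.1), ψ (t.1, t.2.2)) := by
    rintro ⟨q, i, j⟩ ⟨q', i', j'⟩ h
    simp only [Prod.mk.injEq, ψ.injective.eq_iff] at h ⊢
    tauto
  have hle : ∀ q i j, (univ.filter fun b => P q i j b).card ≤ N (ψ (q, i)) (ψ (q, j)) :=
    fun q i j => card_le_card fun b hb => by
      simp only [mem_filter, mem_univ, true_and] at hb ⊢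
      exact ⟨q, i, j, rfl, rfl, hb⟩
  have hblocks : ∑ q, ∑ i, ∑ j, min (univ.filter fun b => P q i j b).card
      (univ.filter fun b => P q j i b).card ≤ 2 * S.card := by
    refine le_trans ?_ hcard
    calc _ ≤ ∑ q, ∑ i, ∑ j, min (N (ψ (q, i)) (ψ (q, j))) (N (ψ (q, j)) (ψ (q, i))) := by
            gcongr <;> exact hle _ _ _
      _ = ∑ t : κ × ι × ι, min (N (ψ (t.1, t.2.1)) (ψ (t.1, t.2.2)))
            (N (ψ (t.1, t.2.2)) (ψ (t.1, t.2.1))) := by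
            simp only [Fintype.sum_prod_type]
      _ = ∑ p ∈ univ.image fun t : κ × ι × ι => (ψ (t.1, t.2.1), ψ (t.1, t.2.2)),
            min (N p.1 p.2) (N p.2 p.1) := by
            rw [sum_image fun x _ y _ h => hinj h]
      _ ≤ ∑ p : Fin m × Fin m, min (N p.1 p.2) (N p.2 p.1) :=
            sum_le_sum_of_subset (subset_univ _)
      _ = _ := by
            rw [Fintype.sum_prod_type]
            congr!
  have hsum := sum_le_sum fun q (_ : q ∈ (univ : Finset κ)) =>
    min_matching_counts_ge hι (fun i b => o (ψ (q, i)) b)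
      (fun i => by simpa using ho (ψ (q, i))) (P q) (hPc q)
  rw [← Nat.cast_sum] at hsum
  have h2 := hsum.trans (Nat.cast_le.2 hblocks)
  simp only [sum_sub_distrib, sum_const, card_univ, nsmul_eq_mul, ← mul_sum,
    Fintype.card_fin] at h2
  push_cast at h2
  have h3 : (0 : ℝ) ≤ Fintype.card κ * n := by positivity
  linarith

lemma abs_sum_dirSign_le {ι : Type*} [Fintype ι] (f : ι → Bool) {δ : ℝ}
    (hT : (1 - δ) * Fintype.card ι / 2 ≤ ((univ.filter fun i => f i = true).card : ℝ))
    (hF : (1 - δ) * Fintype.card ι / 2 ≤ ((univ.filter fun i => f i = false).card : ℝ)) :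
    |∑ i, dirSign (f i)| ≤ δ * Fintype.card ι := by
  have h := card_true_add_card_false f
  rw [sum_dirSign, abs_le]
  constructor <;> linarith

lemma one_div_four_add_sqrt_eight_le : 1 / (4 + Real.sqrt 8) ≤ 15 / 100 := by
  have h : (28 / 10 : ℝ) ≤ Real.sqrt 8 := Real.le_sqrt_of_sq_le (by norm_num)
  rw [div_le_iff₀ (by linarith)]
  linarith

/-- For every `ε > 0` there exist `δ > 0` and `M` such that for all integers `m, n` with
`M ≤ m ≤ n`, every `δ`-Eulerian orientation of `K_{m,n}` contains at least
`(1/(4+√8))·mn·(1−ε)` pairwise arc-disjoint directed 4-cycles. -/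
theorem packing_C4_delta_eulerian_bipartite :
    ∀ ε : ℝ, 0 < ε → ∃ δ : ℝ, 0 < δ ∧ ∃ M : ℕ, ∀ m n : ℕ, M ≤ m → m ≤ n →
      ∀ o : Fin m → Fin n → Bool, IsDeltaEulerianBip δ o →
        ∃ S : Finset (Fin m × Fin m × Fin n × Fin n),
          (∀ q ∈ S, IsDirC4 o q) ∧
          (∀ q ∈ S, ∀ q' ∈ S, q ≠ q' → Disjoint (c4Arcs q) (c4Arcs q')) ∧
          (1 / (4 + Real.sqrt 8)) * m * n * (1 - ε) ≤ S.card := by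
  intro ε hε
  refine ⟨1 / 100, by norm_num, 10000 * 2 ^ 100, fun m n hm hmn o ho => ?_⟩
  have hmR : (10000 * 2 ^ 100 : ℝ) ≤ m := by exact_mod_cast hm
  have hnR : (10000 * 2 ^ 100 : ℝ) ≤ n := hmR.trans (by exact_mod_cast hmn)
  have hφ : Fintype.card (Fin (m / 100) × Fin 100) ≤ Fintype.card (Fin m) := by
    simpa using Nat.div_mul_le_self m 100
  obtain ⟨φ⟩ := Function.Embedding.nonempty_of_card_le hφ
  obtain ⟨ψ, hψ⟩ := exists_balanced_blocks (le_trans (by norm_num) hm) (Fintype.card_fin 100) o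
    (fun b => by
      have := abs_sum_dirSign_le (fun a => o a b) (δ := 1 / 100) (by simpa using (ho.2 b).1)
        (by simpa using (ho.2 b).2)
      rw [Fintype.card_fin] at this
      linarith) φ
  obtain ⟨S, hS, hdis, hcard⟩ := exists_C4_packing_of_blocks (Fintype.card_fin 100) o
    (fun a => by
      have := abs_sum_dirSign_le (fun b => o a b) (δ := 1 / 100) (by simpa using (ho.1 a).1)
        (by simpa using (ho.1 a).2)
      rw [Fintype.card_fin] at this
      linarith) ψ hψ
  refine ⟨S, hS, hdis, ?_⟩
  rw [Fintype.card_fin] at hcard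
  have hg : (m : ℝ) - 99 ≤ 100 * (m / 100 : ℕ) := by
    have : m ≤ 100 * (m / 100) + 99 := by omega
    have : (m : ℝ) ≤ 100 * (m / 100 : ℕ) + 99 := by exact_mod_cast this
    linarith
  set g : ℝ := ((m / 100 : ℕ) : ℝ)
  have hg0 : 0 ≤ g := Nat.cast_nonneg _
  have hmn0 : (0 : ℝ) ≤ m * n := by positivity
  have h1 : 1 / (4 + Real.sqrt 8) * m * n * (1 - ε) ≤ 15 / 100 * (m * n) := by
    have h2 : (0 : ℝ) ≤ 1 / (4 + Real.sqrt 8) := by positivity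
    calc _ = 1 / (4 + Real.sqrt 8) * (m * n) - 1 / (4 + Real.sqrt 8) * (m * n) * ε := by ring
      _ ≤ 1 / (4 + Real.sqrt 8) * (m * n) := by
        have : 0 ≤ 1 / (4 + Real.sqrt 8) * (m * n) * ε := by positivity
        linarith
      _ ≤ _ := mul_le_mul_of_nonneg_right one_div_four_add_sqrt_eight_le hmn0
  have h2 : g * (40 * n) ≤ 2 * S.card := by
    refine le_trans ?_ hcard
    exact mul_le_mul_of_nonneg_left (by linarith) hg0
  have h3 : 30 / 100 * (m : ℝ) ≤ 40 * g := by
    have : (1000 : ℝ) ≤ m := le_trans (by norm_num) hmR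
    linarith
  have h4 : 30 / 100 * (m : ℝ) * n ≤ 40 * g * n := mul_le_mul_of_nonneg_right h3 (by positivity)
  linarith
end
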